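/- (Majorizing measure theorem.) Let T be a finite set and (X_x)_{x∈T} a centered Gaussian process with natural metric d(x,y) := (E|X_x − X_y|²)^{1/2}. Then there are universal constants c, C > 0 such that c·γ₂*(T) ≤ E[ sup_{x∈T} X_x ] ≤ C·γ₂*(T), where γ₂*(T) := inf over sequences of sets T_n ⊆ T with |T_n| < 2^(2^n) of sup_{x∈T} Σ_{n≥0} 2^{n/2} d(x,T_n). -/

import Mathlib

open scoped ENNReal NNReal ProbabilityTheory
open MeasureTheory ProbabilityTheory Set

noncomputable section

universe u v

/-- The natural metric of the process: `d(x,y) = (E|X_x − X_y|²)^{1/2}`. -/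
def natDist {Ω : Type u} {ι : Type v} [MeasureSpace Ω] (X : ι → Ω → ℝ) (x y : ι) : ℝ :=
  Real.sqrt (∫ ω, (X x ω - X y ω) ^ 2)

/-- The Gaussian width `G(A) = E[sup_{x∈A} X_x]`. -/
def gWidth {Ω : Type u} {ι : Type v} [MeasureSpace Ω] (X : ι → Ω → ℝ) (A : Set ι) : ℝ :=
  ∫ ω, sSup ((fun x => X x ω) '' A)

/-- `X` is a centered Gaussian process: every finite linear combination of the
`X_x` is a centered Gaussian random variable. -/
def IsCenteredGaussianProcess {Ω : Type u} {ι : Type v} [MeasureSpace Ω] [Fintype ι]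
    (X : ι → Ω → ℝ) : Prop :=
  (∀ x, Measurable (X x)) ∧
    ∀ c : ι → ℝ, ∃ v : ℝ≥0,
      Measure.map (fun ω => ∑ x, c x * X x ω) ℙ = gaussianReal 0 v

/-- The net-based chaining functional `γ₂*(T)`: infimum over sequences of nets
`T_n ⊆ T` with `|T_n| < 2^(2^n)` of `sup_{x∈T} Σ_n 2^{n/2} d(x,T_n)`. -/
def gammaStar {ι : Type v} (D : ι → ι → ℝ≥0∞) : ℝ≥0∞ :=
  ⨅ (S : ℕ → Finset ι) (_ : ∀ n, (S n).card < 2 ^ 2 ^ n),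
    ⨆ x : ι, ∑' n : ℕ, (2 : ℝ≥0∞) ^ ((n : ℝ) / 2) * ⨅ y ∈ S n, D x y

/-! ### Standard Gaussian measure on `κ → ℝ` and Gaussian integration by parts -/

/-- Standard Gaussian measure on `κ → ℝ`. -/
def gam (κ : Type*) [Fintype κ] : Measure (κ → ℝ) := Measure.pi (fun _ => gaussianReal 0 1)

instance (κ : Type*) [Fintype κ] : IsProbabilityMeasure (gam κ) := by
  unfold gam; infer_instance

/-- The linear form with coefficients `a`. -/
def lin {κ : Type*} [Fintype κ] (a : κ → ℝ) (ω : κ → ℝ) : ℝ := ∑ k, a k * ω k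

/-- Gaussian width of a finite family of vectors. -/
def wid {κ J : Type*} [Fintype κ] (v : J → κ → ℝ) : ℝ := ∫ ω, ⨆ j, lin (v j) ω ∂gam κ

lemma measurable_lin {κ : Type*} [Fintype κ] (a : κ → ℝ) : Measurable (lin a) := by
  unfold lin; fun_prop

lemma integrable_abs_gauss : Integrable (fun x : ℝ => x) (gaussianReal 0 1) :=
  (memLp_id_gaussianReal (μ := 0) (v := 1) 1).integrable (by norm_num)

lemma integrable_coord {κ : Type*} [Fintype κ] (k : κ) :
    Integrable (fun ω : κ → ℝ => ω k) (gam κ) := by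
  have := (measurePreserving_eval (fun _ : κ => gaussianReal 0 1) k)
  exact this.integrable_comp_of_integrable (g := fun x : ℝ => x) integrable_abs_gauss

lemma integrable_lin {κ : Type*} [Fintype κ] (a : κ → ℝ) : Integrable (lin a) (gam κ) := by
  unfold lin
  exact integrable_finsetSum _ fun k _ => (integrable_coord k).const_mul _

lemma integral_coord {κ : Type*} [Fintype κ] (k : κ) : ∫ ω, ω k ∂gam κ = 0 := by
  have h := (measurePreserving_eval (fun _ : κ => gaussianReal 0 1) k)
  have h2 := integral_map (μ := gam κ) (φ := fun ω : κ → ℝ => ω k) (f := fun x : ℝ => x)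
    (measurable_pi_apply k).aemeasurable (by fun_prop)
  rw [← h2]
  have : Measure.map (fun ω : κ → ℝ => ω k) (gam κ) = gaussianReal 0 1 := h.map_eq
  rw [this]; exact integral_id_gaussianReal

lemma integral_lin {κ : Type*} [Fintype κ] (a : κ → ℝ) : ∫ ω, lin a ω ∂gam κ = 0 := by
  unfold lin
  rw [integral_finsetSum _ fun k _ => (integrable_coord k).const_mul _]
  simp [integral_const_mul, integral_coord]

/-- One dimensional Gaussian integration by parts. -/
lemma ibp_one (f f' : ℝ → ℝ) (C : ℝ) (hf' : Measurable f')
    (hd : ∀ x, HasDerivAt f (f' x) x) (hC : ∀ x, |f x| ≤ C) (hC' : ∀ x, |f' x| ≤ C) :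
    ∫ x, x * f x ∂gaussianReal 0 1 = ∫ x, f' x ∂gaussianReal 0 1 := by
  have hf : Measurable f := (continuous_iff_continuousAt.2 fun x => (hd x).continuousAt).measurable
  have i1 : Integrable (fun x => x * f x) (gaussianReal 0 1) :=
    (integrable_abs_gauss.mul_bdd hf.aestronglyMeasurable (Filter.Eventually.of_forall hC))
  have i2 : Integrable f' (gaussianReal 0 1) :=
    Integrable.of_bound hf'.aestronglyMeasurable C (Filter.Eventually.of_forall hC')
  have i3 : Integrable f (gaussianReal 0 1) :=
    Integrable.of_bound hf.aestronglyMeasurable C (Filter.Eventually.of_forall hC)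
  have key : ∀ g : ℝ → ℝ, Integrable g (gaussianReal 0 1) →
      Integrable (fun x => gaussianPDFReal 0 1 x * g x) := by
    intro g hg
    rw [gaussianReal_of_var_ne_zero _ one_ne_zero,
      integrable_withDensity_iff_integrable_smul₀' (by fun_prop)
        (Filter.Eventually.of_forall fun x => gaussianPDF_lt_top)] at hg
    simpa using hg
  have hpd : ∀ x, HasDerivAt (gaussianPDFReal 0 1) (-x * gaussianPDFReal 0 1 x) x := by
    intro x
    unfold gaussianPDFReal
    have h1 : HasDerivAt (fun x : ℝ => -(x - 0) ^ 2 / (2 * ((1 : ℝ≥0) : ℝ))) (-x) x := by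
      have := (((hasDerivAt_id x).sub_const 0).pow 2).neg.div_const (2 * ((1 : ℝ≥0) : ℝ))
      exact this.congr_deriv (by simp; ring)
    have := (h1.exp).const_mul ((Real.sqrt (2 * Real.pi * ((1 : ℝ≥0) : ℝ)))⁻¹)
    exact this.congr_deriv (by ring)
  have h0 := integral_eq_zero_of_hasDerivAt_of_integrable
    (f := fun x => gaussianPDFReal 0 1 x * f x)
    (f' := fun x => gaussianPDFReal 0 1 x * f' x - gaussianPDFReal 0 1 x * (x * f x))
    (fun x => by
      exact ((hpd x).mul (hd x)).congr_deriv (by ring)) ((key _ i2).sub (key _ i1)) (key _ i3)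
  rw [integral_sub (key _ i2) (key _ i1)] at h0
  rw [integral_gaussianReal_eq_integral_smul one_ne_zero,
    integral_gaussianReal_eq_integral_smul one_ne_zero]
  simp only [smul_eq_mul]
  linarith

lemma mp_update {κ : Type*} [Fintype κ] [DecidableEq κ] (k : κ) :
    MeasurePreserving (fun p : (κ → ℝ) × ℝ => Function.update p.1 k p.2)
      ((gam κ).prod (gaussianReal 0 1)) (gam κ) := by
  have hm : Measurable (fun p : (κ → ℝ) × ℝ => Function.update p.1 k p.2) := by
    rw [measurable_pi_iff]
    intro i
    by_cases h : i = k
    · subst h; simp only [Function.update_self]; fun_prop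
    · simp only [Function.update_of_ne h]; fun_prop
  refine ⟨hm, ?_⟩
  unfold gam
  symm
  apply Measure.pi_eq
  intro s hs
  rw [Measure.map_apply hm (MeasurableSet.univ_pi hs)]
  have : (fun p : (κ → ℝ) × ℝ => Function.update p.1 k p.2) ⁻¹' (univ.pi s)
      = (univ.pi (Function.update s k univ)) ×ˢ (s k) := by
    ext ⟨ω, x⟩
    simp only [mem_preimage, mem_pi, mem_univ, forall_true_left, mem_prod]
    constructor
    · intro h
      refine ⟨fun i => ?_, by simpa using h k⟩
      by_cases hi : i = k
      · subst hi; simp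
      · simpa [Function.update_of_ne hi] using h i
    · rintro ⟨h, hk⟩ i
      by_cases hi : i = k
      · subst hi; simpa using hk
      · simpa [Function.update_of_ne hi] using h i
  rw [this, Measure.prod_prod, Measure.pi_pi, ← Finset.mul_prod_erase _ _ (Finset.mem_univ k),
    ← Finset.mul_prod_erase Finset.univ (fun i => gaussianReal 0 1 (s i)) (Finset.mem_univ k)]
  simp only [Function.update_self, measure_univ, one_mul]
  rw [mul_comm]
  congr 1
  apply Finset.prod_congr rfl
  intro i hi
  rw [Function.update_of_ne (Finset.ne_of_mem_erase hi)]

lemma integral_update {κ : Type*} [Fintype κ] [DecidableEq κ] (k : κ) (f : (κ → ℝ) → ℝ)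
    (hf : Integrable f (gam κ)) :
    ∫ ω, f ω ∂gam κ = ∫ ω, ∫ x, f (Function.update ω k x) ∂gaussianReal 0 1 ∂gam κ := by
  have h := mp_update (κ := κ) k
  have h1 : ∫ ω, f ω ∂gam κ = ∫ p, f (Function.update p.1 k p.2)
      ∂((gam κ).prod (gaussianReal 0 1)) := by
    conv_lhs => rw [← h.map_eq]
    rw [integral_map h.measurable.aemeasurable]
    rw [h.map_eq]; exact hf.aestronglyMeasurable
  rw [h1, integral_prod]
  exact h.integrable_comp_of_integrable hf

/-- Gaussian integration by parts. -/
lemma ibp {κ : Type*} [Fintype κ] [DecidableEq κ] (k : κ) (f f' : (κ → ℝ) → ℝ) (C : ℝ)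
    (hf : Measurable f) (hf' : Measurable f')
    (hd : ∀ ω, HasDerivAt (fun x => f (Function.update ω k x)) (f' ω) (ω k))
    (hC : ∀ ω, |f ω| ≤ C) (hC' : ∀ ω, |f' ω| ≤ C) :
    ∫ ω, ω k * f ω ∂gam κ = ∫ ω, f' ω ∂gam κ := by
  have i1 : Integrable (fun ω => ω k * f ω) (gam κ) :=
    ((integrable_coord k).mul_bdd hf.aestronglyMeasurable (Filter.Eventually.of_forall hC))
  have i2 : Integrable f' (gam κ) :=
    Integrable.of_bound hf'.aestronglyMeasurable C (Filter.Eventually.of_forall hC')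
  rw [integral_update k _ i1, integral_update k _ i2]
  congr 1
  funext ω
  have hu : Measurable (fun x : ℝ => Function.update ω k x) := measurable_update ω
  have := ibp_one (fun x => f (Function.update ω k x)) (fun x => f' (Function.update ω k x)) C
    (hf'.comp hu) (fun x => by
      have := hd (Function.update ω k x)
      simpa using this) (fun x => hC _) (fun x => hC' _)
  simpa using this

/-! ### The Sudakov–Fernique inequality -/

/-- Gibbs weights. -/
def gib {J : Type*} [Fintype J] (z : J → ℝ) (j : J) : ℝ := Real.exp (z j) / ∑ i, Real.exp (z i)

lemma sum_exp_pos {J : Type*} [Fintype J] [Nonempty J] (z : J → ℝ) : 0 < ∑ i, Real.exp (z i) :=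
  Finset.sum_pos (fun i _ => Real.exp_pos _) Finset.univ_nonempty

lemma gib_nonneg {J : Type*} [Fintype J] (z : J → ℝ) (j : J) : 0 ≤ gib z j := by
  unfold gib; positivity

lemma gib_sum {J : Type*} [Fintype J] [Nonempty J] (z : J → ℝ) : ∑ j, gib z j = 1 := by
  unfold gib
  rw [← Finset.sum_div, div_self (sum_exp_pos z).ne']

lemma gib_le_one {J : Type*} [Fintype J] [Nonempty J] (z : J → ℝ) (j : J) : gib z j ≤ 1 := by
  rw [← gib_sum z]
  exact Finset.single_le_sum (fun i _ => gib_nonneg z i) (Finset.mem_univ j)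

lemma hasDerivAt_smax {J : Type*} [Fintype J] [Nonempty J] (z : J → ℝ → ℝ) (z' : J → ℝ) (t : ℝ)
    (h : ∀ j, HasDerivAt (z j) (z' j) t) :
    HasDerivAt (fun t => Real.log (∑ j, Real.exp (z j t)))
      (∑ j, gib (fun j => z j t) j * z' j) t := by
  have h1 : HasDerivAt (fun t => ∑ j, Real.exp (z j t)) (∑ j, Real.exp (z j t) * z' j) t :=
    HasDerivAt.fun_sum fun j _ => (h j).exp
  refine (h1.log (sum_exp_pos _).ne').congr_deriv ?_
  rw [Finset.sum_div]
  refine Finset.sum_congr rfl fun j _ => ?_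
  unfold gib; ring

lemma hasDerivAt_gib {J : Type*} [Fintype J] [Nonempty J] (z : J → ℝ → ℝ) (z' : J → ℝ) (t : ℝ)
    (h : ∀ j, HasDerivAt (z j) (z' j) t) (i : J) :
    HasDerivAt (fun t => gib (fun j => z j t) i)
      (gib (fun j => z j t) i * (z' i - ∑ j, gib (fun j => z j t) j * z' j)) t := by
  have h1 : HasDerivAt (fun t => ∑ j, Real.exp (z j t)) (∑ j, Real.exp (z j t) * z' j) t :=
    HasDerivAt.fun_sum fun j _ => (h j).exp
  have hp := (sum_exp_pos (fun j => z j t)).ne'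
  refine ((h i).exp.div h1 hp).congr_deriv ?_
  have : ∑ j, gib (fun j => z j t) j * z' j =
      (∑ j, Real.exp (z j t) * z' j) / ∑ j, Real.exp (z j t) := by
    rw [Finset.sum_div]
    refine Finset.sum_congr rfl fun j _ => ?_
    unfold gib; ring
  rw [this]
  unfold gib
  field_simp

/-- Soft maximum. -/
def smax {J : Type*} [Fintype J] (z : J → ℝ) : ℝ := Real.log (∑ j, Real.exp (z j))

lemma le_smax {J : Type*} [Fintype J] [Nonempty J] (z : J → ℝ) : ⨆ j, z j ≤ smax z := by
  refine ciSup_le fun j => ?_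
  rw [smax, Real.le_log_iff_exp_le (sum_exp_pos z)]
  exact Finset.single_le_sum (f := fun j => Real.exp (z j)) (fun i _ => (Real.exp_pos _).le)
    (Finset.mem_univ j)

lemma smax_le {J : Type*} [Fintype J] [Nonempty J] (z : J → ℝ) :
    smax z ≤ (⨆ j, z j) + Real.log (Fintype.card J) := by
  have hc : (0 : ℝ) < Fintype.card J := by exact_mod_cast Fintype.card_pos
  rw [smax, Real.log_le_iff_le_exp (sum_exp_pos z), Real.exp_add, Real.exp_log hc]
  calc ∑ j, Real.exp (z j) ≤ ∑ j : J, Real.exp (⨆ j, z j) := by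
        refine Finset.sum_le_sum fun j _ => Real.exp_le_exp.2 ?_
        exact le_ciSup (Set.finite_range z).bddAbove j
    _ = _ := by simp [mul_comm]

lemma abs_iSup_le {J : Type*} [Fintype J] [Nonempty J] (z : J → ℝ) : |⨆ j, z j| ≤ ∑ j, |z j| := by
  obtain ⟨j, hj⟩ := exists_eq_ciSup_of_finite (f := z)
  rw [← hj]
  exact Finset.single_le_sum (f := fun j => |z j|) (fun i _ => abs_nonneg _) (Finset.mem_univ j)

lemma integrable_iSup' {Ω J : Type*} [Fintype J] [Nonempty J] {m : MeasurableSpace Ω}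
    {μ : Measure Ω} (Y : J → Ω → ℝ) (hm : ∀ j, Measurable (Y j)) (hY : ∀ j, Integrable (Y j) μ) :
    Integrable (fun ω => ⨆ j, Y j ω) μ := by
  refine Integrable.mono' (integrable_finsetSum Finset.univ fun j _ => (hY j).abs)
    (Measurable.iSup hm).aestronglyMeasurable (Filter.Eventually.of_forall fun ω => ?_)
  exact abs_iSup_le _

lemma integrable_wid {κ J : Type*} [Fintype κ] [Fintype J] [Nonempty J] (v : J → κ → ℝ) :
    Integrable (fun ω => ⨆ j, lin (v j) ω) (gam κ) :=
  integrable_iSup' _ (fun _ => measurable_lin _) fun _ => integrable_lin _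

lemma measurable_smax {Ω J : Type*} [Fintype J] {m : MeasurableSpace Ω}
    (Y : J → Ω → ℝ) (hm : ∀ j, Measurable (Y j)) : Measurable (fun ω => smax fun j => Y j ω) := by
  unfold smax; fun_prop

lemma measurable_gib {Ω J : Type*} [Fintype J] {m : MeasurableSpace Ω}
    (Y : J → Ω → ℝ) (hm : ∀ j, Measurable (Y j)) (i : J) :
    Measurable (fun ω => gib (fun j => Y j ω) i) := by
  unfold gib; fun_prop

lemma integrable_smax {κ J : Type*} [Fintype κ] [Fintype J] [Nonempty J] (v : J → κ → ℝ) :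
    Integrable (fun ω => smax fun j => lin (v j) ω) (gam κ) := by
  refine Integrable.mono' ((integrable_wid v).abs.add (integrable_const (Real.log (Fintype.card J))))
    (measurable_smax _ fun j => measurable_lin _).aestronglyMeasurable
    (Filter.Eventually.of_forall fun ω => ?_)
  have hc : (1 : ℝ) ≤ Fintype.card J := by exact_mod_cast Fintype.card_pos
  have h1 := le_smax fun j => lin (v j) ω
  have h2 := smax_le fun j => lin (v j) ω
  have h3 := Real.log_nonneg hc
  simp only [Real.norm_eq_abs, Pi.add_apply]
  rw [abs_le]
  constructor <;> cases abs_cases (⨆ j, lin (v j) ω) <;> linarith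

/-- The derivative at angle `θ` and its sign. -/
lemma sf_deriv_nonneg {κ J : Type*} [Fintype κ] [Fintype J] [Nonempty J]
    (z z' : J → κ → ℝ) (Δ : J → J → ℝ)
    (hΔ : ∀ i j, ∑ k, z' j k * z i k = Δ i j) (hs : ∀ i j, 0 ≤ Δ i i + Δ j j - Δ i j - Δ j i) :
    0 ≤ ∫ ω, ∑ j, gib (fun j => lin (z j) ω) j * lin (z' j) ω ∂gam κ := by
  classical
  set p : J → (κ → ℝ) → ℝ := fun i ω => gib (fun j => lin (z j) ω) i with hp
  have hpm : ∀ i, Measurable (p i) := fun i => measurable_gib _ (fun j => measurable_lin _) i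
  have hp0 : ∀ i ω, 0 ≤ p i ω := fun i ω => gib_nonneg _ _
  have hp1 : ∀ i ω, p i ω ≤ 1 := fun i ω => gib_le_one _ _
  have hps : ∀ ω, ∑ i, p i ω = 1 := fun ω => gib_sum _
  -- partial derivatives
  set q : κ → J → (κ → ℝ) → ℝ := fun k i ω => p i ω * (z i k - ∑ j, p j ω * z j k) with hq
  have hqm : ∀ k i, Measurable (q k i) := by intro k i; simp only [hq]; fun_prop
  have hqb : ∀ k i ω, |q k i ω| ≤ |z i k| + ∑ j, |z j k| := by
    intro k i ω
    simp only [hq]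
    rw [abs_mul, abs_of_nonneg (hp0 i ω)]
    have h1 : |z i k - ∑ j, p j ω * z j k| ≤ |z i k| + ∑ j, |z j k| := by
      refine (abs_sub _ _).trans (add_le_add le_rfl ?_)
      refine (Finset.abs_sum_le_sum_abs _ _).trans (Finset.sum_le_sum fun j _ => ?_)
      rw [abs_mul, abs_of_nonneg (hp0 j ω)]
      exact mul_le_of_le_one_left (abs_nonneg _) (hp1 j ω)
    calc _ ≤ 1 * _ := mul_le_mul (hp1 i ω) h1 (abs_nonneg _) zero_le_one
      _ = _ := one_mul _
  have hder : ∀ k i ω, HasDerivAt (fun x => p i (Function.update ω k x)) (q k i ω) (ω k) := by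
    intro k i ω
    have hl : ∀ j, HasDerivAt (fun x => lin (z j) (Function.update ω k x)) (z j k) (ω k) := by
      intro j
      unfold lin
      have : ∀ l ∈ Finset.univ, HasDerivAt (fun x => z j l * Function.update ω k x l)
          (if l = k then z j k else 0) (ω k) := by
        intro l _
        by_cases h : l = k
        · subst h
          simp only [Function.update_self, if_true]
          simpa using (hasDerivAt_id (ω l)).const_mul (z j l)
        · simp only [Function.update_of_ne h, if_neg h]
          exact hasDerivAt_const _ _
      refine (HasDerivAt.fun_sum this).congr_deriv ?_
      simp
    have := hasDerivAt_gib (fun j x => lin (z j) (Function.update ω k x)) (fun j => z j k) (ω k) hl i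
    simpa only [Function.update_eq_self] using this
  have hibp : ∀ k i, ∫ ω, ω k * p i ω ∂gam κ = ∫ ω, q k i ω ∂gam κ := by
    intro k i
    refine ibp k (p i) (q k i) (1 + (|z i k| + ∑ j, |z j k|)) (hpm i) (hqm k i) (hder k i) ?_ ?_
    · intro ω
      rw [abs_of_nonneg (hp0 i ω)]
      have : 0 ≤ (|z i k| + ∑ j, |z j k|) := by positivity
      linarith [hp1 i ω]
    · intro ω; linarith [hqb k i ω]
  have i1 : ∀ k i, Integrable (fun ω => ω k * p i ω) (gam κ) := fun k i =>
    (integrable_coord k).mul_bdd (c := 1) (hpm i).aestronglyMeasurable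
      (Filter.Eventually.of_forall fun ω => by
        rw [Real.norm_eq_abs, abs_of_nonneg (hp0 i ω)]; exact hp1 i ω)
  have i2 : ∀ k i, Integrable (q k i) (gam κ) := fun k i =>
    Integrable.of_bound (hqm k i).aestronglyMeasurable _
      (Filter.Eventually.of_forall fun ω => hqb k i ω)
  have e1 : ∫ ω, ∑ j, p j ω * lin (z' j) ω ∂gam κ
      = ∫ ω, ∑ j, ∑ k, z' j k * q k j ω ∂gam κ := by
    calc ∫ ω, ∑ j, p j ω * lin (z' j) ω ∂gam κ
        = ∫ ω, ∑ j, ∑ k, z' j k * (ω k * p j ω) ∂gam κ := by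
          congr 1; funext ω
          refine Finset.sum_congr rfl fun j _ => ?_
          unfold lin
          rw [Finset.mul_sum]
          refine Finset.sum_congr rfl fun k _ => by ring
      _ = ∑ j, ∑ k, z' j k * ∫ ω, ω k * p j ω ∂gam κ := by
          rw [integral_finsetSum _ fun j _ => integrable_finsetSum _ fun k _ => (i1 k j).const_mul _]
          refine Finset.sum_congr rfl fun j _ => ?_
          rw [integral_finsetSum _ fun k _ => (i1 k j).const_mul _]
          refine Finset.sum_congr rfl fun k _ => ?_
          rw [integral_const_mul]
      _ = ∑ j, ∑ k, z' j k * ∫ ω, q k j ω ∂gam κ := by simp only [hibp]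
      _ = _ := by
          rw [integral_finsetSum _ fun j _ => integrable_finsetSum _ fun k _ => (i2 k j).const_mul _]
          refine Finset.sum_congr rfl fun j _ => ?_
          rw [integral_finsetSum _ fun k _ => (i2 k j).const_mul _]
          refine Finset.sum_congr rfl fun k _ => ?_
          rw [integral_const_mul]
  change 0 ≤ ∫ ω, ∑ j, p j ω * lin (z' j) ω ∂gam κ
  rw [e1]
  refine integral_nonneg fun ω => ?_
  simp only [Pi.zero_apply]
  have e2 : ∑ j, ∑ k, z' j k * q k j ω
      = ∑ j, p j ω * Δ j j - ∑ j, ∑ i, p j ω * p i ω * Δ i j := by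
    rw [← Finset.sum_sub_distrib]
    refine Finset.sum_congr rfl fun j _ => ?_
    have : ∀ k, z' j k * q k j ω = p j ω * (z' j k * z j k)
        - ∑ i, p j ω * p i ω * (z' j k * z i k) := by
      intro k
      simp only [hq]
      rw [mul_sub, mul_sub, Finset.mul_sum, Finset.mul_sum]
      congr 1
      · ring
      · exact Finset.sum_congr rfl fun i _ => by ring
    simp only [this]
    rw [Finset.sum_sub_distrib, ← Finset.mul_sum, hΔ, Finset.sum_comm]
    congr 1
    refine Finset.sum_congr rfl fun i _ => ?_
    rw [← Finset.mul_sum, hΔ]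
  have e3 : ∑ j, p j ω * Δ j j = ∑ j, ∑ i, p j ω * p i ω * Δ j j := by
    refine Finset.sum_congr rfl fun j _ => ?_
    rw [← Finset.sum_mul, ← Finset.mul_sum, hps, mul_one]
  have e4 : ∑ j, p j ω * Δ j j = ∑ j, ∑ i, p j ω * p i ω * Δ i i := by
    rw [Finset.sum_comm]
    refine Finset.sum_congr rfl fun j _ => ?_
    rw [← Finset.sum_mul, ← Finset.sum_mul, hps, one_mul]
  have e5 : ∑ j, ∑ i, p j ω * p i ω * Δ i j = ∑ j, ∑ i, p j ω * p i ω * Δ j i := by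
    rw [Finset.sum_comm]
    exact Finset.sum_congr rfl fun j _ => Finset.sum_congr rfl fun i _ => by ring
  have e6 : 0 ≤ ∑ j, ∑ i, p j ω * p i ω * (Δ i i + Δ j j - Δ i j - Δ j i) :=
    Finset.sum_nonneg fun j _ => Finset.sum_nonneg fun i _ =>
      mul_nonneg (mul_nonneg (hp0 j ω) (hp0 i ω)) (hs i j)
  simp only [mul_sub, mul_add, Finset.sum_sub_distrib, Finset.sum_add_distrib] at e6
  rw [e2]
  linarith

lemma lin_add {κ : Type*} [Fintype κ] (a b ω : κ → ℝ) : lin (a + b) ω = lin a ω + lin b ω := by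
  simp [lin, add_mul, Finset.sum_add_distrib]

lemma lin_sub {κ : Type*} [Fintype κ] (a b ω : κ → ℝ) : lin (a - b) ω = lin a ω - lin b ω := by
  simp [lin, sub_mul, Finset.sum_sub_distrib]

lemma lin_smul {κ : Type*} [Fintype κ] (c : ℝ) (a ω : κ → ℝ) : lin (c • a) ω = c * lin a ω := by
  simp [lin, mul_assoc, Finset.mul_sum]

/-- Comparison of soft maxima, orthogonal version. -/
lemma sf_smax {κ J : Type*} [Fintype κ] [Fintype J] [Nonempty J]
    (a b : J → κ → ℝ) (hab : ∀ i j, ∑ k, a i k * b j k = 0)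
    (h : ∀ i j, ∑ k, (a i k - a j k) ^ 2 ≤ ∑ k, (b i k - b j k) ^ 2) :
    ∫ ω, smax (fun j => lin (a j) ω) ∂gam κ ≤ ∫ ω, smax (fun j => lin (b j) ω) ∂gam κ := by
  set z : ℝ → J → κ → ℝ := fun θ j => Real.cos θ • a j + Real.sin θ • b j with hz
  set z' : ℝ → J → κ → ℝ := fun θ j => (-Real.sin θ) • a j + Real.cos θ • b j with hz'
  set φ : ℝ → ℝ := fun θ => ∫ ω, smax (fun j => lin (z θ j) ω) ∂gam κ with hφ
  have hlz : ∀ θ j ω, lin (z θ j) ω = Real.cos θ * lin (a j) ω + Real.sin θ * lin (b j) ω := by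
    intro θ j ω; simp only [hz, lin_add, lin_smul]
  have hlz' : ∀ θ j ω, lin (z' θ j) ω = -Real.sin θ * lin (a j) ω + Real.cos θ * lin (b j) ω := by
    intro θ j ω; simp only [hz', lin_add, lin_smul]
  have hd : ∀ θ, HasDerivAt φ
      (∫ ω, ∑ j, gib (fun j => lin (z θ j) ω) j * lin (z' θ j) ω ∂gam κ) θ := by
    intro θ
    refine (hasDerivAt_integral_of_dominated_loc_of_deriv_le (μ := gam κ)
      (F := fun θ ω => smax (fun j => lin (z θ j) ω))
      (F' := fun θ ω => ∑ j, gib (fun j => lin (z θ j) ω) j * lin (z' θ j) ω)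
      (bound := fun ω => ∑ j, (|lin (a j) ω| + |lin (b j) ω|)) (s := univ) (x₀ := θ)
      Filter.univ_mem ?_ ?_ ?_ ?_ ?_ ?_).2
    · exact Filter.Eventually.of_forall fun θ =>
        (measurable_smax _ fun j => measurable_lin _).aestronglyMeasurable
    · exact integrable_smax _
    · refine Measurable.aestronglyMeasurable ?_
      refine Finset.measurable_fun_sum _ fun j _ => ?_
      exact (measurable_gib _ (fun j => measurable_lin _) j).mul (measurable_lin _)
    · refine Filter.Eventually.of_forall fun ω θ _ => ?_
      refine (Finset.abs_sum_le_sum_abs _ _).trans (Finset.sum_le_sum fun j _ => ?_)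
      rw [abs_mul, abs_of_nonneg (gib_nonneg _ _)]
      refine (mul_le_of_le_one_left (abs_nonneg _) (gib_le_one _ _)).trans ?_
      rw [hlz']
      refine (abs_add_le _ _).trans (add_le_add ?_ ?_)
      · rw [abs_mul, abs_neg]
        exact mul_le_of_le_one_left (abs_nonneg _) (Real.abs_sin_le_one θ)
      · rw [abs_mul]
        exact mul_le_of_le_one_left (abs_nonneg _) (Real.abs_cos_le_one θ)
    · exact integrable_finsetSum _ fun j _ => (integrable_lin _).abs.add (integrable_lin _).abs
    · refine Filter.Eventually.of_forall fun ω θ _ => ?_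
      refine hasDerivAt_smax (fun j θ => lin (z θ j) ω) (fun j => lin (z' θ j) ω) θ fun j => ?_
      simp only [hlz, hlz']
      exact ((Real.hasDerivAt_cos θ).mul_const _).add ((Real.hasDerivAt_sin θ).mul_const _)
  have hmono : MonotoneOn φ (Icc 0 (Real.pi / 2)) := by
    refine monotoneOn_of_deriv_nonneg (convex_Icc _ _)
      (fun θ _ => (hd θ).continuousAt.continuousWithinAt)
      (fun θ _ => (hd θ).differentiableAt.differentiableWithinAt) fun θ hθ => ?_
    rw [interior_Icc] at hθ
    rw [(hd θ).deriv]
    have hc : 0 ≤ Real.cos θ := Real.cos_nonneg_of_mem_Icc ⟨by linarith [hθ.1, Real.pi_pos], hθ.2.le⟩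
    have hs : 0 ≤ Real.sin θ := Real.sin_nonneg_of_mem_Icc ⟨hθ.1.le, by linarith [hθ.2, Real.pi_pos]⟩
    refine sf_deriv_nonneg (z θ) (z' θ) (fun i j => Real.sin θ * Real.cos θ *
      (∑ k, b i k * b j k - ∑ k, a i k * a j k)) ?_ ?_
    · intro i j
      have : ∀ k, z' θ j k * z θ i k = Real.sin θ * Real.cos θ * (b i k * b j k)
          - Real.sin θ * Real.cos θ * (a i k * a j k) + Real.cos θ ^ 2 * (a i k * b j k)
          - Real.sin θ ^ 2 * (a j k * b i k) := by
        intro k; simp only [hz, hz', Pi.add_apply, Pi.smul_apply, smul_eq_mul]; ring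
      simp only [this, Finset.sum_sub_distrib, Finset.sum_add_distrib, ← Finset.mul_sum, hab]
      ring
    · intro i j
      have hh := h i j
      have ea : ∀ c : J → κ → ℝ, ∑ k, (c i k - c j k) ^ 2 = ∑ k, c i k * c i k + ∑ k, c j k * c j k
          - ∑ k, c i k * c j k - ∑ k, c j k * c i k := by
        intro c
        rw [← Finset.sum_add_distrib, ← Finset.sum_sub_distrib, ← Finset.sum_sub_distrib]
        exact Finset.sum_congr rfl fun k _ => by ring
      rw [ea, ea] at hh
      have : 0 ≤ Real.sin θ * Real.cos θ := mul_nonneg hs hc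
      nlinarith
  have h0 := hmono (left_mem_Icc.2 (by positivity)) (right_mem_Icc.2 (by positivity))
    (by positivity : (0 : ℝ) ≤ Real.pi / 2)
  simpa [hφ, hz] using h0

lemma wid_smul {κ J : Type*} [Fintype κ] [Fintype J] [Nonempty J] (v : J → κ → ℝ) (c : ℝ)
    (hc : 0 ≤ c) : wid (fun j => c • v j) = c * wid v := by
  unfold wid
  rw [← integral_const_mul]
  congr 1; funext ω
  simp only [lin_smul]
  rw [Real.mul_iSup_of_nonneg hc]

lemma sf_orth {κ J : Type*} [Fintype κ] [Fintype J] [Nonempty J]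
    (a b : J → κ → ℝ) (hab : ∀ i j, ∑ k, a i k * b j k = 0)
    (h : ∀ i j, ∑ k, (a i k - a j k) ^ 2 ≤ ∑ k, (b i k - b j k) ^ 2) :
    wid a ≤ wid b := by
  have key : ∀ c : ℝ, 0 < c → c * wid a ≤ c * wid b + Real.log (Fintype.card J) := by
    intro c hc
    rw [← wid_smul a c hc.le, ← wid_smul b c hc.le]
    have h1 := sf_smax (fun j => c • a j) (fun j => c • b j)
      (fun i j => by
        have : ∀ k, (c • a i) k * (c • b j) k = c ^ 2 * (a i k * b j k) := by
          intro k; simp; ring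
        simp only [this, ← Finset.mul_sum, hab, mul_zero])
      (fun i j => by
        have : ∀ (a : J → κ → ℝ) k, ((c • a i) k - (c • a j) k) ^ 2 = c ^ 2 * (a i k - a j k) ^ 2 := by
          intro a k; simp; ring
        simp only [this, ← Finset.mul_sum]
        exact mul_le_mul_of_nonneg_left (h i j) (by positivity))
    have h2 : wid (fun j => c • a j) ≤ ∫ ω, smax (fun j => lin (c • a j) ω) ∂gam κ :=
      integral_mono (integrable_wid _) (integrable_smax _) fun ω => le_smax _
    have h3 : ∫ ω, smax (fun j => lin (c • b j) ω) ∂gam κ ≤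
        wid (fun j => c • b j) + Real.log (Fintype.card J) := by
      have : wid (fun j => c • b j) + Real.log (Fintype.card J) =
          ∫ ω, ((⨆ j, lin (c • b j) ω) + Real.log (Fintype.card J)) ∂gam κ := by
        rw [integral_add (integrable_wid _) (integrable_const _)]
        simp [wid]
      rw [this]
      exact integral_mono (integrable_smax _) ((integrable_wid _).add (integrable_const _))
        fun ω => smax_le _
    linarith
  by_contra! hcon
  set L := Real.log (Fintype.card J)
  have hL : 0 ≤ L := Real.log_nonneg (by exact_mod_cast Fintype.card_pos)
  have := key ((L + 1) / (wid a - wid b)) (div_pos (by linarith) (by linarith))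
  have e : (L + 1) / (wid a - wid b) * (wid a - wid b) = L + 1 :=
    div_mul_cancel₀ _ (by linarith)
  nlinarith

/-! ### The growth condition -/

lemma mp_elim (A B : Type*) [Fintype A] [Fintype B] :
    MeasurePreserving (fun p : (A → ℝ) × (B → ℝ) => (Sum.elim p.1 p.2 : A ⊕ B → ℝ))
      ((gam A).prod (gam B)) (gam (A ⊕ B)) := by
  have := measurePreserving_sumPiEquivProdPi_symm (X := fun _ : A ⊕ B => ℝ)
    (fun _ : A ⊕ B => gaussianReal 0 1)
  have e : (fun p : (A → ℝ) × (B → ℝ) => (Sum.elim p.1 p.2 : A ⊕ B → ℝ))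
      = (MeasurableEquiv.sumPiEquivProdPi fun _ : A ⊕ B => ℝ).symm := by
    funext p
    ext i
    cases i <;> rfl
  rw [e]
  exact this

lemma integral_elim {A B : Type*} [Fintype A] [Fintype B] (f : (A ⊕ B → ℝ) → ℝ)
    (hf : Integrable f (gam (A ⊕ B))) :
    Integrable (fun p : (A → ℝ) × (B → ℝ) => f (Sum.elim p.1 p.2)) ((gam A).prod (gam B)) ∧
    ∫ ω, f ω ∂gam (A ⊕ B) = ∫ x, ∫ y, f (Sum.elim x y) ∂gam B ∂gam A := by
  have h := mp_elim A B
  have h0 : Integrable (fun p : (A → ℝ) × (B → ℝ) => f (Sum.elim p.1 p.2))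
    ((gam A).prod (gam B)) := h.integrable_comp_of_integrable hf
  refine ⟨h0, ?_⟩
  have h1 : ∫ ω, f ω ∂gam (A ⊕ B) = ∫ p, f (Sum.elim p.1 p.2) ∂((gam A).prod (gam B)) := by
    conv_lhs => rw [← h.map_eq]
    rw [integral_map h.measurable.aemeasurable]
    rw [h.map_eq]; exact hf.aestronglyMeasurable
  rw [h1, integral_prod _ h0]

lemma lin_elim {A B : Type*} [Fintype A] [Fintype B] (a x : A → ℝ) (b y : B → ℝ) :
    lin (Sum.elim a b) (Sum.elim x y) = lin a x + lin b y := by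
  simp [lin]

lemma lin_zero {A : Type*} [Fintype A] (x : A → ℝ) : lin (0 : A → ℝ) x = 0 := by
  simp [lin]

lemma wid_inl {A B J : Type*} [Fintype A] [Fintype B] [Fintype J] [Nonempty J] (a : J → A → ℝ) :
    wid (fun j => (Sum.elim (a j) 0 : A ⊕ B → ℝ)) = wid a := by
  unfold wid
  rw [(integral_elim _ (integrable_wid _)).2]
  simp [lin_elim, lin_zero]

lemma wid_inr {A B J : Type*} [Fintype A] [Fintype B] [Fintype J] [Nonempty J] (b : J → B → ℝ) :
    wid (fun j => (Sum.elim 0 (b j) : A ⊕ B → ℝ)) = wid b := by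
  unfold wid
  rw [(integral_elim _ (integrable_wid _)).2]
  simp [lin_elim, lin_zero]

/-- **Sudakov–Fernique inequality**. -/
lemma sudakov_fernique {A B J : Type*} [Fintype A] [Fintype B] [Fintype J] [Nonempty J]
    (a : J → A → ℝ) (b : J → B → ℝ)
    (h : ∀ i j, ∑ k, (a i k - a j k) ^ 2 ≤ ∑ k, (b i k - b j k) ^ 2) : wid a ≤ wid b := by
  rw [← wid_inl (B := B) a, ← wid_inr (A := A) b]
  refine sf_orth _ _ ?_ ?_
  · intro i j; simp
  · intro i j; simpa using h i j

/-- Euclidean distance. -/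
def ed {κ : Type*} [Fintype κ] (u v : κ → ℝ) : ℝ :=
  dist (WithLp.toLp 2 u : EuclideanSpace ℝ κ) (WithLp.toLp 2 v)

lemma ed_nonneg {κ : Type*} [Fintype κ] (u v : κ → ℝ) : 0 ≤ ed u v := dist_nonneg
lemma ed_comm {κ : Type*} [Fintype κ] (u v : κ → ℝ) : ed u v = ed v u := dist_comm _ _
lemma ed_self {κ : Type*} [Fintype κ] (u : κ → ℝ) : ed u u = 0 := dist_self _
lemma ed_triangle {κ : Type*} [Fintype κ] (u v w : κ → ℝ) : ed u w ≤ ed u v + ed v w :=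
  dist_triangle _ _ _
lemma ed_eq {κ : Type*} [Fintype κ] (u v : κ → ℝ) : ed u v = Real.sqrt (∑ k, (u k - v k) ^ 2) := by
  unfold ed; rw [EuclideanSpace.dist_eq]; simp [Real.dist_eq, sq_abs]
lemma ed_sq {κ : Type*} [Fintype κ] (u v : κ → ℝ) : ed u v ^ 2 = ∑ k, (u k - v k) ^ 2 := by
  rw [ed_eq, Real.sq_sqrt (by positivity)]
lemma ed_sub_sub {κ : Type*} [Fintype κ] (u v u' v' : κ → ℝ) :
    ed (u - u') (v - v') ≤ ed u' u + ed v' v := by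
  unfold ed
  rw [dist_comm (WithLp.toLp 2 u')]
  simp only [dist_eq_norm, WithLp.toLp_sub]
  rw [norm_sub_rev (WithLp.toLp 2 v')]
  exact norm_sub_le _ _

lemma wid_mono {κ J J' : Type*} [Fintype κ] [Fintype J] [Nonempty J] [Fintype J'] 
    (v : J' → κ → ℝ) (f : J → J') : wid (fun j => v (f j)) ≤ wid v := by
  have : Nonempty J' := ⟨f (Classical.arbitrary J)⟩
  refine integral_mono (integrable_wid _) (integrable_wid _) fun ω => ?_
  exact ciSup_le fun j => le_ciSup (f := fun j => lin (v j) ω) (Set.finite_range _).bddAbove (f j)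

lemma wid_nonneg {κ J : Type*} [Fintype κ] [Fintype J] [Nonempty J]
    (v : J → κ → ℝ) : 0 ≤ wid v := by
  have j := Classical.arbitrary J
  have : ∫ ω, lin (v j) ω ∂gam κ ≤ wid v :=
    integral_mono (integrable_lin _) (integrable_wid _) fun ω =>
      le_ciSup (f := fun j => lin (v j) ω) (Set.finite_range _).bddAbove j
  rwa [integral_lin] at this

/-- A quarter of the first absolute moment of a standard Gaussian. -/
def c0 : ℝ := (∫ x, |x| ∂gaussianReal 0 1) / 4

lemma c0_pos : 0 < c0 := by
  unfold c0
  refine div_pos ?_ (by norm_num)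
  rw [integral_pos_iff_support_of_nonneg (fun x => abs_nonneg x) integrable_abs_gauss.abs]
  have : Function.support (fun x : ℝ => |x|) = {0}ᶜ := by ext x; simp
  rw [this]
  have := nullSingletonClass_gaussianReal (μ := 0) (v := 1) one_ne_zero
  rw [measure_compl (measurableSet_singleton _) (measure_ne_top _ _)]
  simp

lemma integral_sum_abs (k : ℕ) : ∫ ω : Fin k → ℝ, ∑ i, |ω i| ∂gam (Fin k) = k * (4 * c0) := by
  rw [integral_finsetSum _ fun i _ => (integrable_coord i).abs]
  have : ∀ i : Fin k, ∫ ω : Fin k → ℝ, |ω i| ∂gam (Fin k) = 4 * c0 := by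
    intro i
    have h := (measurePreserving_eval (fun _ : Fin k => gaussianReal 0 1) i)
    have h2 := integral_map (μ := gam (Fin k)) (φ := fun ω : Fin k → ℝ => ω i)
      (f := fun x : ℝ => |x|) (measurable_pi_apply i).aemeasurable (by fun_prop)
    rw [← h2]
    have : Measure.map (fun ω : Fin k → ℝ => ω i) (gam (Fin k)) = gaussianReal 0 1 := h.map_eq
    rw [this]; unfold c0; ring
  simp [this]

/-- Sign of a Boolean. -/
def sg (b : Bool) : ℝ := if b then 1 else -1

lemma growth {κ J : Type*} [Fintype κ] [Fintype J] (v : J → κ → ℝ) (k : ℕ) (hk : 0 < k)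
    (P : (Fin k → Bool) → J) (ε : ℝ) (hε : 0 ≤ ε)
    (hsep : ∀ l l', l ≠ l' → ε ≤ ed (v (P l)) (v (P l'))) :
    ∃ l, wid (fun x : {x // ed (v (P l)) (v x) ≤ ε / 8} => v x) + c0 * ε * Real.sqrt k ≤
      wid (fun x : {x // ∃ l, ed (v (P l)) (v x) ≤ ε / 8} => v x) := by
  classical
  have hne : ∀ l, Nonempty {x // ed (v (P l)) (v x) ≤ ε / 8} := fun l =>
    ⟨⟨P l, by rw [ed_self]; positivity⟩⟩
  set J' := Σ l : Fin k → Bool, {x // ed (v (P l)) (v x) ≤ ε / 8} with hJ'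
  have : Nonempty J' := ⟨⟨fun _ => true, Classical.choice (hne _)⟩⟩
  have hk' : (0 : ℝ) < k := by exact_mod_cast hk
  set b : ℝ := ε / (4 * Real.sqrt k) with hb
  have hb0 : 0 ≤ b := by positivity
  have hbk : b ^ 2 * k = ε ^ 2 / 16 := by
    rw [hb, div_pow, mul_pow, Real.sq_sqrt hk'.le]; field_simp; norm_num
  set Y : J' → (Fin k ⊕ κ) → ℝ := fun j =>
    Sum.elim (fun i => b * sg (j.1 i)) (v j.2.1 - v (P j.1)) with hY
  have h1 : wid Y ≤ wid (fun j : J' => v j.2.1) := by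
    refine sudakov_fernique _ _ fun i j => ?_
    rw [← ed_sq, ← ed_sq]
    by_cases hij : i.1 = j.1
    · rw [ed_sq, ed_sq]
      simp [hY, hij]
    · rw [ed_sq]
      have e : ∑ m, (Y i m - Y j m) ^ 2 = b ^ 2 * ∑ m, (sg (i.1 m) - sg (j.1 m)) ^ 2
          + ed (v i.2.1 - v (P i.1)) (v j.2.1 - v (P j.1)) ^ 2 := by
        rw [ed_sq, Fintype.sum_sum_type, Finset.mul_sum]
        congr 1
        refine Finset.sum_congr rfl fun m _ => ?_
        simp only [hY, Sum.elim_inl]; ring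
      rw [e]
      have s1 : ∑ m, (sg (i.1 m) - sg (j.1 m)) ^ 2 ≤ 4 * k := by
        calc ∑ m, (sg (i.1 m) - sg (j.1 m)) ^ 2 ≤ ∑ m : Fin k, (4 : ℝ) := by
              refine Finset.sum_le_sum fun m _ => ?_
              cases i.1 m <;> cases j.1 m <;> norm_num [sg]
          _ = 4 * k := by simp [mul_comm]
      have s2 := ed_sub_sub (v i.2.1) (v j.2.1) (v (P i.1)) (v (P j.1))
      have s3 := ed_nonneg (v i.2.1 - v (P i.1)) (v j.2.1 - v (P j.1))
      have s4 := i.2.2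
      have s5 := j.2.2
      have s6 := hsep _ _ hij
      have s7 := ed_triangle (v (P i.1)) (v i.2.1) (v (P j.1))
      have s8 := ed_triangle (v i.2.1) (v j.2.1) (v (P j.1))
      rw [ed_comm (v j.2.1) (v (P j.1))] at s8
      have s9 : 3 / 4 * ε ≤ ed (v i.2.1) (v j.2.1) := by linarith
      have s10 : b ^ 2 * ∑ m, (sg (i.1 m) - sg (j.1 m)) ^ 2 ≤ ε ^ 2 / 4 := by
        calc _ ≤ b ^ 2 * (4 * k) := mul_le_mul_of_nonneg_left s1 (by positivity)
          _ = ε ^ 2 / 4 := by linarith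
      have s11 : ed (v i.2.1 - v (P i.1)) (v j.2.1 - v (P j.1)) ^ 2 ≤ (ε / 4) ^ 2 :=
        pow_le_pow_left₀ s3 (by linarith) 2
      have s12 : (3 / 4 * ε) ^ 2 ≤ ed (v i.2.1) (v j.2.1) ^ 2 :=
        pow_le_pow_left₀ (by positivity) s9 2
      nlinarith
  have h2 : wid (fun j : J' => v j.2.1) ≤
      wid (fun x : {x // ∃ l, ed (v (P l)) (v x) ≤ ε / 8} => v x) :=
    wid_mono (fun x : {x // ∃ l, ed (v (P l)) (v x) ≤ ε / 8} => v x)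
      (fun j : J' => ⟨j.2.1, j.1, j.2.2⟩)
  obtain ⟨l0, hl0⟩ := Finite.exists_min
    (fun l => wid (fun x : {x // ed (v (P l)) (v x) ≤ ε / 8} => v x))
  refine ⟨l0, ?_⟩
  set m := wid (fun x : {x // ed (v (P l0)) (v x) ≤ ε / 8} => v x) with hm
  have h3 : m + c0 * ε * Real.sqrt k ≤ wid Y := by
    unfold wid
    obtain ⟨hi, he⟩ := integral_elim _ (integrable_wid Y)
    rw [he]
    have e1 : m + c0 * ε * Real.sqrt k = ∫ x : Fin k → ℝ, (m + b * ∑ i, |x i|) ∂gam (Fin k) := by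
      rw [integral_add (integrable_const _) ((integrable_finsetSum _ fun i _ =>
        (integrable_coord i).abs).const_mul _), integral_const_mul, integral_sum_abs]
      simp only [integral_const, probReal_univ, smul_eq_mul, one_mul]
      have : b * k = ε * Real.sqrt k / 4 := by
        rw [hb]
        have : (k : ℝ) = Real.sqrt k * Real.sqrt k := (Real.mul_self_sqrt hk'.le).symm
        have hs : Real.sqrt k ≠ 0 := (Real.sqrt_pos.2 hk').ne'
        rw [div_mul_eq_mul_div, div_eq_div_iff (by positivity) (by norm_num)]
        linear_combination (4 * ε) * this
      linear_combination (-4 * c0) * this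
    rw [e1]
    refine integral_mono ((integrable_const _).add ((integrable_finsetSum _ fun i _ =>
        (integrable_coord i).abs).const_mul _)) hi.integral_prod_left fun x => ?_
    simp only
    set l : Fin k → Bool := fun i => decide (0 ≤ x i) with hl
    have := hne l
    have e2 : ∫ y, ((⨆ w : {w // ed (v (P l)) (v w) ≤ ε / 8}, lin (v w) y)
        + (b * ∑ i, |x i| - lin (v (P l)) y)) ∂gam κ
        = wid (fun w : {w // ed (v (P l)) (v w) ≤ ε / 8} => v w) + b * ∑ i, |x i| := by
      have hi2 : Integrable (fun y => b * ∑ i, |x i| - lin (v (P l)) y) (gam κ) :=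
        (integrable_const _).sub (integrable_lin _)
      rw [integral_add (integrable_wid _) hi2, integral_sub (integrable_const _) (integrable_lin _), integral_lin]
      simp [wid]
    calc m + b * ∑ i, |x i|
        ≤ wid (fun w : {w // ed (v (P l)) (v w) ≤ ε / 8} => v w) + b * ∑ i, |x i| := by
          gcongr; exact hl0 l
      _ = _ := e2.symm
      _ ≤ _ := by
        refine integral_mono ((integrable_wid _).add ((integrable_const _).sub (integrable_lin _)))
          ?_ fun y => ?_
        · refine integrable_iSup' _ (fun j => ?_) fun j => ?_
          · simp only [hY, lin_elim]
            exact (measurable_lin _).const_add _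
          · simp only [hY, lin_elim]
            exact (integrable_const _).add (integrable_lin _)
        · simp only
          rw [← le_sub_iff_add_le]
          refine ciSup_le fun w => ?_
          rw [le_sub_iff_add_le]
          refine le_trans (le_of_eq ?_) (le_ciSup (f := fun j => lin (Y j) (Sum.elim x y))
            (Set.finite_range _).bddAbove ⟨l, w⟩)
          simp only [hY, lin_elim, lin_sub]
          have : lin (fun i => b * sg (l i)) x = b * ∑ i, |x i| := by
            unfold lin
            rw [Finset.mul_sum]
            refine Finset.sum_congr rfl fun i _ => ?_
            simp only [hl, sg, decide_eq_true_eq]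
            split_ifs with h
            · rw [abs_of_nonneg h]; ring
            · rw [abs_of_neg (not_le.1 h)]; ring
          rw [this]; ring
  linarith

/-! ### Interpolation -/

/-- Gaussian width of a ball. -/
def Gb {κ ι : Type*} [Fintype κ] (v : ι → κ → ℝ) (x : ι) (r : ℝ) : ℝ :=
  wid (fun y : {y // ed (v x) (v y) ≤ r} => v y)

lemma Gb_mono {κ ι : Type*} [Fintype κ] [Fintype ι] (v : ι → κ → ℝ) (x : ι) {r r' : ℝ}
    (hr : 0 ≤ r) (h : ∀ y, ed (v x) (v y) ≤ r → ed (v x) (v y) ≤ r') : Gb v x r ≤ Gb v x r' := by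
  classical
  have : Nonempty {y // ed (v x) (v y) ≤ r} := ⟨⟨x, by rw [ed_self]; exact hr⟩⟩
  exact wid_mono (fun y : {y // ed (v x) (v y) ≤ r'} => v y)
    (fun y : {y // ed (v x) (v y) ≤ r} => ⟨y.1, h _ y.2⟩)

lemma Gb_le {κ ι : Type*} [Fintype κ] [Fintype ι] (v : ι → κ → ℝ) (x : ι) {r : ℝ}
    (hr : 0 ≤ r) : Gb v x r ≤ wid v := by
  classical
  have : Nonempty {y // ed (v x) (v y) ≤ r} := ⟨⟨x, by rw [ed_self]; exact hr⟩⟩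
  exact wid_mono v (fun y : {y // ed (v x) (v y) ≤ r} => y.1)

lemma Gb_nonneg {κ ι : Type*} [Fintype κ] [Fintype ι] (v : ι → κ → ℝ) (x : ι) {r : ℝ}
    (hr : 0 ≤ r) : 0 ≤ Gb v x r := by
  classical
  have : Nonempty {y // ed (v x) (v y) ≤ r} := ⟨⟨x, by rw [ed_self]; exact hr⟩⟩
  exact wid_nonneg _

lemma exists_argmin {κ ι : Type*} [Fintype κ] [Fintype ι] (v : ι → κ → ℝ) (t : ℝ) (x : ι) :
    ∃ y, ∀ z, t * ed (v x) (v y) - Gb v x (ed (v x) (v y)) ≤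
      t * ed (v x) (v z) - Gb v x (ed (v x) (v z)) := by
  have : Nonempty ι := ⟨x⟩
  exact Finite.exists_min (fun y => t * ed (v x) (v y) - Gb v x (ed (v x) (v y)))

/-- The interpolation radius. -/
def sfun {κ ι : Type*} [Fintype κ] [Fintype ι] (v : ι → κ → ℝ) (t : ℝ) (x : ι) : ℝ :=
  ed (v x) (v (Classical.choose (exists_argmin v t x)))

lemma sfun_nonneg {κ ι : Type*} [Fintype κ] [Fintype ι] (v : ι → κ → ℝ) (t : ℝ) (x : ι) :
    0 ≤ sfun v t x := ed_nonneg _ _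

lemma sfun_min {κ ι : Type*} [Fintype κ] [Fintype ι] (v : ι → κ → ℝ) (t : ℝ) (ht : 0 ≤ t) (x : ι)
    (u : ℝ) (hu : 0 ≤ u) : t * sfun v t x - Gb v x (sfun v t x) ≤ t * u - Gb v x u := by
  classical
  have hne : (Finset.univ.filter fun y => ed (v x) (v y) ≤ u).Nonempty :=
    ⟨x, by simp [ed_self, hu]⟩
  obtain ⟨y, hy, hmax⟩ := Finset.exists_max_image _ (fun y => ed (v x) (v y)) hne
  simp only [Finset.mem_filter, Finset.mem_univ, true_and] at hy hmax
  have h1 := Classical.choose_spec (exists_argmin v t x) y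
  have h2 : Gb v x u ≤ Gb v x (ed (v x) (v y)) := Gb_mono v x hu hmax
  have h3 : t * ed (v x) (v y) ≤ t * u := mul_le_mul_of_nonneg_left hy ht
  unfold sfun
  linarith

lemma sqrt2_pos : 0 < Real.sqrt 2 := by positivity
lemma sqrt2_sq : Real.sqrt 2 * Real.sqrt 2 = 2 := Real.mul_self_sqrt (by norm_num)
lemma sqrt2_ge : 4 / 3 ≤ Real.sqrt 2 := Real.le_sqrt_of_sq_le (by norm_num)

lemma sfun_sum {κ ι : Type*} [Fintype κ] [Fintype ι] (v : ι → κ → ℝ) (a : ℝ) (ha : 0 < a) (x : ι)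
    (M : ℕ) : ∑ n ∈ Finset.range M, Real.sqrt 2 ^ n * sfun v (a * Real.sqrt 2 ^ n) x
      ≤ 4 / a * wid v := by
  set T : ℕ → ℝ := fun n => a * Real.sqrt 2 ^ n / Real.sqrt 2 with hT
  have hT0 : ∀ n, 0 ≤ T n := fun n => by positivity
  have hT1 : ∀ n, T (n + 1) = a * Real.sqrt 2 ^ n := by
    intro n; simp only [hT, pow_succ]; field_simp
  set K : ℝ → ℝ := fun t => t * sfun v t x - Gb v x (sfun v t x) with hK
  have step : ∀ n, a / 4 * (Real.sqrt 2 ^ n * sfun v (a * Real.sqrt 2 ^ n) x) ≤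
      K (T (n + 1)) - K (T n) := by
    intro n
    have h1 := sfun_min v (T n) (hT0 n) x (sfun v (T (n + 1)) x) (sfun_nonneg _ _ _)
    have h2 : a / 4 * Real.sqrt 2 ^ n ≤ T (n + 1) - T n := by
      rw [hT1]
      have : T n * 4 ≤ a * Real.sqrt 2 ^ n * 3 := by
        have e : T n * Real.sqrt 2 = a * Real.sqrt 2 ^ n := by
          simp only [hT]; field_simp
        nlinarith [sqrt2_ge, hT0 n]
      linarith
    rw [← hT1]
    have h3 := mul_le_mul_of_nonneg_right h2 (sfun_nonneg v (T (n + 1)) x)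
    simp only [hK]
    linarith
  have tot : a / 4 * ∑ n ∈ Finset.range M, Real.sqrt 2 ^ n * sfun v (a * Real.sqrt 2 ^ n) x
      ≤ K (T M) - K (T 0) := by
    rw [← Finset.sum_range_sub (fun n => K (T n)), Finset.mul_sum]
    exact Finset.sum_le_sum fun n _ => step n
  have k1 : K (T M) ≤ 0 := by
    have := sfun_min v (T M) (hT0 M) x 0 le_rfl
    have h2 := Gb_nonneg v x le_rfl
    simp only [hK]; linarith
  have k2 : -wid v ≤ K (T 0) := by
    have h2 := Gb_le v x (sfun_nonneg v (T 0) x)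
    have h3 := mul_nonneg (hT0 0) (sfun_nonneg v (T 0) x)
    simp only [hK]; linarith
  rw [div_mul_eq_mul_div, le_div_iff₀ ha]
  linarith

lemma no_pack {κ ι : Type*} [Fintype κ] [Fintype ι] (v : ι → κ → ℝ) (η : ℝ) (hη : 0 < η)
    (hη1 : η ≤ 1) (n : ℕ) (A : Set ι) (ε : ℝ) (hε : 0 < ε)
    (h1 : ∀ x ∈ A, ∀ y ∈ A, η * ed (v x) (v y) ≤ ε)
    (h2 : ∀ x ∈ A, 8 * sfun v (c0 * η / 2 * Real.sqrt 2 ^ n) x ≤ ε)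
    (P : (Fin (2 ^ n) → Bool) → ι) (hP : ∀ l, P l ∈ A)
    (hsep : ∀ l l', l ≠ l' → ε ≤ ed (v (P l)) (v (P l'))) : False := by
  classical
  obtain ⟨l, hl⟩ := growth v (2 ^ n) (by positivity) P ε hε.le hsep
  have hs : Real.sqrt ((2 ^ n : ℕ) : ℝ) = Real.sqrt 2 ^ n := by
    push_cast
    rw [Real.sqrt_eq_iff_mul_self_eq (by positivity) (by positivity), ← mul_pow, sqrt2_sq]
  rw [hs] at hl
  set u := ε / η + ε / 8 with hu
  have hc := c0_pos
  have hu0 : 0 ≤ u := by positivity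
  have h3 : wid (fun x : {x // ∃ l, ed (v (P l)) (v x) ≤ ε / 8} => v x) ≤ Gb v (P l) u := by
    have : Nonempty {x // ∃ l, ed (v (P l)) (v x) ≤ ε / 8} :=
      ⟨⟨P l, l, by rw [ed_self]; positivity⟩⟩
    refine wid_mono (fun y : {y // ed (v (P l)) (v y) ≤ u} => v y)
      (fun y : {x // ∃ l, ed (v (P l)) (v x) ≤ ε / 8} => ⟨y.1, ?_⟩)
    obtain ⟨l', hl'⟩ := y.2
    have h4 : ed (v (P l)) (v (P l')) ≤ ε / η := by
      rw [le_div_iff₀ hη, mul_comm]; exact h1 _ (hP l) _ (hP l')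
    have := ed_triangle (v (P l)) (v (P l')) (v y.1)
    linarith
  set t := c0 * η / 2 * Real.sqrt 2 ^ n with ht
  have ht0 : 0 < t := by positivity
  have h4 := sfun_min v t ht0.le (P l) u hu0
  have h5 : Gb v (P l) (sfun v t (P l)) ≤ Gb v (P l) (ε / 8) :=
    Gb_mono v _ (sfun_nonneg _ _ _) fun y hy => hy.trans (by linarith [h2 _ (hP l)])
  have h6 := mul_nonneg ht0.le (sfun_nonneg v t (P l))
  have h7 : Gb v (P l) (ε / 8) + c0 * ε * Real.sqrt 2 ^ n ≤ Gb v (P l) u := hl.trans h3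
  have h8 : t * u = c0 * Real.sqrt 2 ^ n * ε * (1 / 2 + η / 16) := by
    rw [ht, hu]; field_simp; ring
  have h9 : 0 < c0 * Real.sqrt 2 ^ n * ε := by positivity
  nlinarith

/-! ### Nets -/

lemma exists_net {ι : Type*} [Fintype ι] (d : ι → ι → ℝ) (hd0 : ∀ x, d x x = 0)
    (hsymm : ∀ x y, d x y = d y x)
    (k : ℕ) (A : Set ι) (ε : ℝ) (hε : 0 < ε)
    (h : ∀ P : (Fin k → Bool) → ι, (∀ l, P l ∈ A) → (∀ l l', l ≠ l' → ε ≤ d (P l) (P l')) → False) :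
    ∃ C : Finset ι, C.card < 2 ^ k ∧ ∀ x ∈ A, ∃ y ∈ C, d x y ≤ ε := by
  classical
  set F : Finset (Finset ι) := Finset.univ.filter fun C =>
    (∀ x ∈ C, x ∈ A) ∧ ∀ x ∈ C, ∀ y ∈ C, x ≠ y → ε ≤ d x y with hF
  have hne : F.Nonempty := ⟨∅, by simp [hF]⟩
  obtain ⟨C, hC, hmax⟩ := Finset.exists_max_image F Finset.card hne
  simp only [hF, Finset.mem_filter, Finset.mem_univ, true_and] at hC hmax
  refine ⟨C, ?_, ?_⟩
  · by_contra! hcard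
    have : Fintype.card (Fin k → Bool) ≤ Fintype.card C := by simpa using hcard
    obtain ⟨e⟩ := Function.Embedding.nonempty_of_card_le this
    refine h (fun l => (e l).1) (fun l => hC.1 _ (e l).2) fun l l' hll => ?_
    refine hC.2 _ (e l).2 _ (e l').2 fun heq => hll (e.injective (Subtype.ext heq))
  · intro x hx
    by_contra! hcon
    have hxC : x ∉ C := fun hxC => by
      have := hcon x hxC
      rw [hd0] at this; linarith
    have := hmax (insert x C) ⟨?_, ?_⟩
    · rw [Finset.card_insert_of_notMem hxC] at this; omega
    · intro y hy
      rcases Finset.mem_insert.1 hy with rfl | hy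
      · exact hx
      · exact hC.1 y hy
    · intro y hy z hz hyz
      rcases Finset.mem_insert.1 hy with hy2 | hy2
      · rcases Finset.mem_insert.1 hz with hz2 | hz2
        · exact absurd (hy2.trans hz2.symm) hyz
        · rw [hy2]; exact (hcon z hz2).le
      · rcases Finset.mem_insert.1 hz with hz2 | hz2
        · rw [hz2, hsymm]; exact (hcon y hy2).le
        · exact hC.2 y hy2 z hz2 hyz

lemma level {ι : Type*} [Fintype ι] [Nonempty ι] (d : ι → ι → ℝ) (hd0 : ∀ x, d x x = 0)
    (hsymm : ∀ x y, d x y = d y x) (htri : ∀ x y z, d x z ≤ d x y + d y z)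
    (hnn : ∀ x y, 0 ≤ d x y)
    (D : ℝ) (hD : ∀ x y, d x y ≤ D) (η : ℝ) (hη : 0 < η) (hη1 : η ≤ 1) (n : ℕ)
    (s : ι → ℝ) (hs : ∀ x, 0 ≤ s x) (hsD : ∀ x, s x ≤ D)
    (hpack : ∀ (A : Set ι) (ε : ℝ), 0 < ε → (∀ x ∈ A, ∀ y ∈ A, η * d x y ≤ ε) →
      (∀ x ∈ A, 8 * s x ≤ ε) → ∀ P : (Fin (2 ^ n) → Bool) → ι, (∀ l, P l ∈ A) →
      (∀ l l', l ≠ l' → ε ≤ d (P l) (P l')) → False)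
    (N : Finset ι) (hN : N.card < 2 ^ 2 ^ n) (p : ι → ι) (hp : ∀ x, p x ∈ N) :
    ∃ C : Finset ι, C.card < 2 ^ 2 ^ (n + 2) ∧ ∀ x, ∃ y ∈ C,
      d x y ≤ 4 * η * d x (p x) + 16 * s x + 10 * D * (1 / 2) ^ n := by
  classical
  have hD0 : 0 ≤ D := (hnn (Classical.arbitrary ι) (Classical.arbitrary ι)).trans (hD _ _)
  rcases hD0.eq_or_lt with hD00 | hDpos
  · refine ⟨{Classical.arbitrary ι}, ?_, fun x => ⟨Classical.arbitrary ι, by simp, ?_⟩⟩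
    · simp
    · have := hD x (Classical.arbitrary ι)
      have h1 := hnn x (p x)
      have h2 := hs x
      have h3 : 0 ≤ 4 * η * d x (p x) := by positivity
      rw [← hD00] at this ⊢
      linarith
  set w : ι → ℝ := fun x => 2 * η * d x (p x) + 8 * s x with hw
  have hwD : ∀ x, w x ≤ 10 * D := by
    intro x
    have h1 := hD x (p x)
    have h2 := hsD x
    have h3 := hnn x (p x)
    simp only [hw]
    nlinarith
  set e : ℕ → ℝ := fun k => 10 * D * (1 / 2) ^ k with he
  have hepos : ∀ k, 0 < e k := fun k => by positivity
  set kk : ι → ℕ := fun x => Nat.findGreatest (fun k => w x ≤ e k) n with hkk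
  have hk1 : ∀ x, w x ≤ e (kk x) := by
    intro x
    exact Nat.findGreatest_spec (P := fun k => w x ≤ e k) (Nat.zero_le n) (by simpa [he] using hwD x)
  have hk2 : ∀ x, kk x ≤ n := fun x => Nat.findGreatest_le n
  have hk3 : ∀ x, e (kk x) ≤ 2 * w x + e n := by
    intro x
    have hw0 : 0 ≤ w x := by
      have := hnn x (p x); have := hs x
      simp only [hw]; positivity
    rcases (hk2 x).eq_or_lt with h | h
    · rw [h]; linarith
    · have := Nat.findGreatest_is_greatest (P := fun k => w x ≤ e k) (n := n)
        (Nat.lt_succ_self (kk x)) h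
      simp only [not_le] at this
      have e2 : e (kk x).succ = e (kk x) / 2 := by simp only [he, Nat.succ_eq_add_one, pow_succ]; ring
      rw [e2] at this
      linarith [hepos n]
  have hcell : ∀ (y : ι) (k : ℕ), ∃ C : Finset ι, C.card < 2 ^ 2 ^ n ∧
      ∀ x ∈ {x | p x = y ∧ kk x = k}, ∃ z ∈ C, d x z ≤ e k := by
    intro y k
    refine exists_net d hd0 hsymm (2 ^ n) _ (e k) (hepos k) (hpack _ _ (hepos k) ?_ ?_)
    · rintro x ⟨hx1, hx2⟩ x' ⟨hx1', hx2'⟩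
      have a1 := htri x y x'
      have a2 := hk1 x
      have a3 := hk1 x'
      have a4 := hs x
      have a5 := hs x'
      rw [hsymm y x'] at a1
      rw [hx2] at a2
      rw [hx2'] at a3
      simp only [hw, hx1, hx1'] at a2 a3
      have := mul_le_mul_of_nonneg_left a1 hη.le
      linarith
    · rintro x ⟨hx1, hx2⟩
      have a2 := hk1 x
      rw [hx2] at a2
      have : 0 ≤ 2 * η * d x (p x) := by have := hnn x (p x); positivity
      simp only [hw] at a2
      linarith
  choose C hC1 hC2 using hcell
  refine ⟨N.biUnion fun y => (Finset.range (n + 1)).biUnion fun k => C y k, ?_, ?_⟩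
  · set m := 2 ^ 2 ^ n with hm
    have hm2 : 2 ≤ m := by
      calc 2 = 2 ^ 1 := rfl
        _ ≤ 2 ^ 2 ^ n := Nat.pow_le_pow_right (by norm_num) Nat.one_le_two_pow
    have hnm : n + 1 ≤ m := (Nat.lt_two_pow_self (n := n)).trans (Nat.lt_two_pow_self (n := 2 ^ n)) |>.nat_succ_le
    have b1 : (N.biUnion fun y => (Finset.range (n + 1)).biUnion fun k => C y k).card
        ≤ N.card * ((n + 1) * m) := by
      refine Finset.card_biUnion_le_card_mul _ _ _ fun y _ => ?_
      refine (Finset.card_biUnion_le_card_mul _ _ m fun k _ => (hC1 y k).le).trans ?_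
      simp
    have b2 : N.card * ((n + 1) * m) ≤ m * (m * m) := by gcongr
    have b3 : 2 ^ 2 ^ (n + 2) = m * (m * m) * m := by
      rw [hm, pow_add, pow_mul]; ring
    rw [b3]
    have : 0 < m * (m * m) := by positivity
    nlinarith
  · intro x
    obtain ⟨z, hz, hxz⟩ := hC2 (p x) (kk x) x ⟨rfl, rfl⟩
    refine ⟨z, ?_, ?_⟩
    · simp only [Finset.mem_biUnion, Finset.mem_range]
      exact ⟨p x, hp x, kk x, Nat.lt_succ_of_le (hk2 x), hz⟩
    · have := hk3 x
      simp only [hw] at this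
      have e3 : e n = 10 * D * (1 / 2) ^ n := rfl
      linarith

lemma diam_le {κ ι : Type*} [Fintype κ] [Fintype ι] (v : ι → κ → ℝ) (x y : ι) :
    ed (v x) (v y) ≤ wid v / c0 := by
  classical
  rw [le_div_iff₀ c0_pos]
  obtain ⟨l, hl⟩ := growth v 1 (by norm_num) (fun l => if l 0 then x else y) (ed (v x) (v y))
    (ed_nonneg _ _) (by
      intro l l' hll
      have : l 0 ≠ l' 0 := fun h => hll (by ext i; rw [Subsingleton.elim i 0, h])
      cases h : l 0 <;> cases h' : l' 0
      · simp_all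
      · simp [ed_comm]
      · simp
      · simp_all)
  have : Nonempty {z // ∃ l : Fin 1 → Bool, ed (v (if l 0 then x else y)) (v z)
      ≤ ed (v x) (v y) / 8} := ⟨⟨x, fun _ => true, by
        simp only [if_true]; rw [ed_self]; have := ed_nonneg (v x) (v y); positivity⟩⟩
  have h2 := wid_mono v (fun z : {z // ∃ l : Fin 1 → Bool, ed (v (if l 0 then x else y)) (v z)
      ≤ ed (v x) (v y) / 8} => z.1)
  have h3 := Gb_nonneg v (if l 0 then x else y)
    (r := ed (v x) (v y) / 8) (by have := ed_nonneg (v x) (v y); positivity)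
  unfold Gb at h3
  simp only [Nat.cast_one, Real.sqrt_one, mul_one] at hl
  linarith

/-! ### The lower bound for canonical processes -/

lemma two_rpow_half (n : ℕ) : (2 : ℝ≥0∞) ^ ((n : ℝ) / 2) = ENNReal.ofReal (Real.sqrt 2 ^ n) := by
  have h2 : (2 : ℝ≥0∞) = ENNReal.ofReal 2 := by simp
  rw [h2, ENNReal.ofReal_rpow_of_pos (by norm_num), Real.sqrt_eq_rpow, ← Real.rpow_natCast,
    ← Real.rpow_mul (by norm_num)]
  congr 2
  ring

lemma near {ι : Type*} (S : Finset ι) (hS : S.Nonempty) (f : ι → ℝ≥0∞) :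
    ∃ p ∈ S, ⨅ y ∈ S, f y = f p := by
  obtain ⟨p, hp, h⟩ := Finset.exists_min_image S f hS
  exact ⟨p, hp, le_antisymm (iInf₂_le p hp) (le_iInf₂ h)⟩

lemma geom34 (M : ℕ) : ∑ i ∈ Finset.range M, (3 / 4 : ℝ) ^ i ≤ 4 := by
  have : ∑ i ∈ Finset.range M, (3 / 4 : ℝ) ^ i = 4 - 4 * (3 / 4) ^ M := by
    induction M with
    | zero => simp
    | succ n ih => rw [Finset.sum_range_succ, ih, pow_succ]; ring
  rw [this]
  have : (0 : ℝ) ≤ (3 / 4) ^ M := by positivity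
  linarith

lemma sqrt2_le : Real.sqrt 2 ≤ 3 / 2 := by
  rw [Real.sqrt_le_left (by norm_num)]; norm_num

/-- The value of a sequence of nets. -/
def val {ι : Type*} (D : ι → ι → ℝ≥0∞) (S : ℕ → Finset ι) : ℝ≥0∞ :=
  ⨆ x : ι, ∑' n : ℕ, (2 : ℝ≥0∞) ^ ((n : ℝ) / 2) * ⨅ y ∈ S n, D x y

lemma val_eq_top {ι : Type*} [Nonempty ι] (D : ι → ι → ℝ≥0∞) (S : ℕ → Finset ι) (n : ℕ)
    (h : S n = ∅) : val D S = ⊤ := by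
  rw [eq_top_iff]
  refine le_trans ?_ (le_iSup _ (Classical.arbitrary ι))
  refine le_trans ?_ (ENNReal.le_tsum n)
  rw [two_rpow_half, h]
  simp only [Finset.notMem_empty, iInf_false, iInf_top]
  rw [ENNReal.mul_top]
  rw [← pos_iff_ne_zero, ENNReal.ofReal_pos]
  have := sqrt2_pos
  positivity

lemma gammaStar_le {ι : Type*} (D : ι → ι → ℝ≥0∞) (S : ℕ → Finset ι)
    (hS : ∀ n, (S n).card < 2 ^ 2 ^ n) : gammaStar D ≤ val D S := iInf₂_le S hS

lemma gammaStar_ne_top {ι : Type*} [Fintype ι] [Nonempty ι] (D : ι → ι → ℝ≥0∞)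
    (hD0 : ∀ x, D x x = 0) (B : ℝ≥0∞) (hB : B ≠ ⊤) (hD : ∀ x y, D x y ≤ B) :
    gammaStar D ≠ ⊤ := by
  classical
  set M := Fintype.card ι with hM
  have hMM : ∀ n, M ≤ n → M < 2 ^ 2 ^ n := fun n hn =>
    hn.trans_lt ((Nat.lt_two_pow_self (n := n)).trans (Nat.lt_two_pow_self (n := 2 ^ n)))
  set S : ℕ → Finset ι := fun n => if M ≤ n then Finset.univ else {Classical.arbitrary ι} with hS
  have hS1 : ∀ n, (S n).card < 2 ^ 2 ^ n := by
    intro n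
    by_cases h : M ≤ n
    · simp only [hS, if_pos h, Finset.card_univ]; exact hMM n h
    · simp only [hS, if_neg h, Finset.card_singleton]
      exact Nat.one_lt_two_pow (by positivity)
  have h1 : val D S ≤ ∑ n ∈ Finset.range M, ENNReal.ofReal (Real.sqrt 2 ^ n) * B := by
    refine iSup_le fun x => ?_
    rw [tsum_eq_sum (s := Finset.range M)]
    · refine Finset.sum_le_sum fun n hn => ?_
      rw [two_rpow_half]
      gcongr
      have hn' : ¬ M ≤ n := by simpa using hn
      simp only [hS, if_neg hn', Finset.mem_singleton, iInf_iInf_eq_left]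
      exact hD _ _
    · intro n hn
      have hn' : M ≤ n := by simpa using hn
      have : ⨅ y ∈ S n, D x y = 0 := by
        refine le_antisymm ?_ zero_le
        rw [← hD0 x]
        exact iInf₂_le x (by simp [hS, hn'])
      rw [this, mul_zero]
  refine ne_top_of_le_ne_top ?_ ((gammaStar_le D S hS1).trans h1)
  exact ENNReal.sum_ne_top.2 fun n _ => ENNReal.mul_ne_top ENNReal.ofReal_ne_top hB

/-- Constant in the lower bound. -/
def K0 : ℝ := 83 / c0 + 128 * 32 / c0

lemma K0_pos : 0 < K0 := by
  have := c0_pos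
  unfold K0; positivity

/-- Shifted sequences of nets. -/
def shiftS {ι : Type*} (x0 : ι) (C : ℕ → Finset ι) : ℕ → Finset ι
  | 0 => {x0}
  | 1 => {x0}
  | n + 2 => C n

lemma exists_shift {ι : Type*} (x0 : ι) (C : ℕ → Finset ι) (hC : ∀ n, (C n).card < 2 ^ 2 ^ (n + 2)) :
    ∃ S : ℕ → Finset ι, (∀ n, (S n).card < 2 ^ 2 ^ n) ∧ S 0 = {x0} ∧ S (0 + 1) = {x0} ∧
      ∀ n, S (n + 1 + 1) = C n := by
  refine ⟨shiftS x0 C, ?_, rfl, rfl, fun n => rfl⟩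
  intro n
  rcases n with _ | _ | n
  · simp [shiftS]
  · simp [shiftS]
  · exact hC n

lemma tsum_split (f : ℕ → ℝ≥0∞) : ∑' n, f n = f 0 + (f (0 + 1) + ∑' n, f (n + 1 + 1)) := by
  have h1 : ∑' n, f n = f 0 + ∑' n, f (n + 1) := tsum_eq_zero_add' ENNReal.summable
  have h2 : ∑' n, f (n + 1) = f (0 + 1) + ∑' n, f (n + 1 + 1) :=
    tsum_eq_zero_add' (f := fun n => f (n + 1)) ENNReal.summable
  rw [h1, h2]

lemma improve {κ ι : Type*} [Fintype κ] [Fintype ι] [Nonempty ι] (v : ι → κ → ℝ)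
    (N : ℕ → Finset ι) (hN : ∀ n, (N n).card < 2 ^ 2 ^ n) :
    gammaStar (fun x y => ENNReal.ofReal (ed (v x) (v y))) ≤
      ENNReal.ofReal (1 / 2) * val (fun x y => ENNReal.ofReal (ed (v x) (v y))) N
        + ENNReal.ofReal (K0 * wid v) := by
  classical
  set D : ι → ι → ℝ≥0∞ := fun x y => ENNReal.ofReal (ed (v x) (v y)) with hD
  by_cases hne : ∀ n, (N n).Nonempty
  swap
  · simp only [not_forall, Finset.not_nonempty_iff_eq_empty] at hne
    obtain ⟨n, hn⟩ := hne
    rw [val_eq_top D N n hn, ENNReal.mul_top (by simp)]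
    simp
  have hc := c0_pos
  have hs2 := sqrt2_pos
  have hw : 0 ≤ wid v := wid_nonneg v
  choose p hp hpe using fun n x => near (N n) (hne n) (D x)
  set a : ℝ := c0 * (1 / 16) / 2 with ha
  have ha0 : 0 < a := by positivity
  set D0 := wid v / c0 with hD0
  have hD00 : 0 ≤ D0 := by positivity
  have hsD : ∀ t x, sfun v t x ≤ D0 := fun t x => diam_le v _ _
  have hlev : ∀ n, ∃ C : Finset ι, C.card < 2 ^ 2 ^ (n + 2) ∧ ∀ x, ∃ y ∈ C,
      ed (v x) (v y) ≤ 4 * (1 / 16) * ed (v x) (v (p n x)) + 16 * sfun v (a * Real.sqrt 2 ^ n) x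
        + 10 * D0 * (1 / 2) ^ n := fun n =>
    level (fun x y => ed (v x) (v y)) (fun x => ed_self _) (fun x y => ed_comm _ _)
      (fun x y z => ed_triangle _ _ _) (fun x y => ed_nonneg _ _) D0 (fun x y => diam_le v x y)
      (1 / 16) (by norm_num) (by norm_num) n (sfun v (a * Real.sqrt 2 ^ n))
      (fun x => sfun_nonneg _ _ _) (fun x => hsD _ x)
      (fun A ε hε h1 h2 P hP hsep => no_pack v (1 / 16) (by norm_num) (by norm_num) n A ε hε h1
        h2 P hP hsep) (N n) (hN n) (p n) (fun x => hp n x)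
  choose C hC1 hC2 using hlev
  set x0 : ι := Classical.arbitrary ι
  obtain ⟨S, hS1, hSz, hSo, hSn⟩ := exists_shift x0 C hC1
  refine (gammaStar_le D S hS1).trans (iSup_le fun x => ?_)
  have hx : ∑' n : ℕ, (2 : ℝ≥0∞) ^ ((n : ℝ) / 2) * ⨅ y ∈ N n, D x y ≤ val D N :=
    le_iSup (fun x => ∑' n : ℕ, (2 : ℝ≥0∞) ^ ((n : ℝ) / 2) * ⨅ y ∈ N n, D x y) x
  have hterm : ∀ n : ℕ, (2 : ℝ≥0∞) ^ (((n + 1 + 1 : ℕ) : ℝ) / 2) * ⨅ y ∈ S (n + 1 + 1), D x y ≤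
      ENNReal.ofReal (1 / 2) * ((2 : ℝ≥0∞) ^ ((n : ℝ) / 2) * ⨅ y ∈ N n, D x y) +
      (ENNReal.ofReal (32 * (Real.sqrt 2 ^ n * sfun v (a * Real.sqrt 2 ^ n) x)) +
       ENNReal.ofReal (20 * D0 * (3 / 4) ^ n)) := by
    intro n
    obtain ⟨y, hy, hyd⟩ := hC2 n x
    have h0 : ⨅ y ∈ S (n + 1 + 1), D x y ≤ D x y := iInf₂_le y (by rw [hSn]; exact hy)
    have h34 : Real.sqrt 2 ^ n * (1 / 2) ^ n ≤ (3 / 4) ^ n := by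
      rw [← mul_pow]
      exact pow_le_pow_left₀ (by positivity) (by linarith [sqrt2_le]) n
    have hs0 := sfun_nonneg v (a * Real.sqrt 2 ^ n) x
    have he0 := ed_nonneg (v x) (v (p n x))
    refine (mul_le_mul_right h0 _).trans ?_
    rw [hpe, two_rpow_half, two_rpow_half]
    simp only [hD]
    rw [← ENNReal.ofReal_mul (by positivity), ← ENNReal.ofReal_mul (by positivity),
      ← ENNReal.ofReal_mul (by positivity), ← ENNReal.ofReal_add (by positivity) (by positivity),
      ← ENNReal.ofReal_add (by positivity) (by positivity)]
    refine ENNReal.ofReal_le_ofReal ?_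
    have e1 : Real.sqrt 2 ^ (n + 1 + 1) = 2 * Real.sqrt 2 ^ n := by
      rw [pow_succ, pow_succ, mul_assoc, sqrt2_sq]; ring
    rw [e1]
    have h5 := mul_le_mul_of_nonneg_left hyd (show 0 ≤ 2 * Real.sqrt 2 ^ n by positivity)
    have h6 := mul_le_mul_of_nonneg_left h34 (show 0 ≤ 20 * D0 by positivity)
    nlinarith
  have hD0x : ∀ x y, D x y ≤ ENNReal.ofReal D0 := fun x y =>
    ENNReal.ofReal_le_ofReal (diam_le v x y)
  have t0 : (2 : ℝ≥0∞) ^ (((0 : ℕ) : ℝ) / 2) * ⨅ y ∈ S 0, D x y ≤ ENNReal.ofReal D0 := by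
    rw [two_rpow_half]
    simp only [hSz, pow_zero, ENNReal.ofReal_one, one_mul, Finset.mem_singleton, iInf_iInf_eq_left]
    exact hD0x _ _
  have t1 : (2 : ℝ≥0∞) ^ (((0 + 1 : ℕ) : ℝ) / 2) * ⨅ y ∈ S (0 + 1), D x y
      ≤ ENNReal.ofReal (2 * D0) := by
    rw [two_rpow_half]
    rw [hSo]
    simp only [Finset.mem_singleton, iInf_iInf_eq_left, zero_add, pow_one]
    rw [ENNReal.ofReal_mul (by norm_num)]
    exact mul_le_mul' (ENNReal.ofReal_le_ofReal (by linarith [sqrt2_le])) (hD0x _ _)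
  have s1 : ∑' n : ℕ, ENNReal.ofReal (32 * (Real.sqrt 2 ^ n * sfun v (a * Real.sqrt 2 ^ n) x))
      ≤ ENNReal.ofReal (32 * (4 / a * wid v)) := by
    refine ENNReal.tsum_le_of_sum_range_le fun M => ?_
    rw [← ENNReal.ofReal_sum_of_nonneg, ← Finset.mul_sum]
    · refine ENNReal.ofReal_le_ofReal ?_
      have := sfun_sum v a ha0 x M
      linarith
    · intro n _
      have hs0 := sfun_nonneg v (a * Real.sqrt 2 ^ n) x
      positivity
  have s2 : ∑' n : ℕ, ENNReal.ofReal (20 * D0 * (3 / 4) ^ n) ≤ ENNReal.ofReal (80 * D0) := by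
    refine ENNReal.tsum_le_of_sum_range_le fun M => ?_
    rw [← ENNReal.ofReal_sum_of_nonneg, ← Finset.mul_sum]
    · refine ENNReal.ofReal_le_ofReal ?_
      have := mul_le_mul_of_nonneg_left (geom34 M) (show 0 ≤ 20 * D0 by positivity)
      linarith
    · intro n _; positivity
  have hsum := ENNReal.tsum_le_tsum hterm
  rw [ENNReal.tsum_add, ENNReal.tsum_add, ENNReal.tsum_mul_left] at hsum
  rw [tsum_split]
  generalize wid v = w at *
  clear_value D0 a
  refine (add_le_add t0 (add_le_add t1 (hsum.trans (add_le_add (mul_le_mul_right hx _)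
    (add_le_add s1 s2))))).trans ?_
  have hK : K0 * w = D0 + (2 * D0 + (32 * (4 / a * w) + 80 * D0)) := by
    rw [hD0, ha]; unfold K0; field_simp; ring
  rw [hK, ENNReal.ofReal_add hD00 (by positivity),
    ENNReal.ofReal_add (by positivity) (by positivity),
    ENNReal.ofReal_add (by positivity) (by positivity)]
  generalize val D N = V
  refine le_of_eq ?_
  ring

lemma lower {κ ι : Type*} [Fintype κ] [Fintype ι] [Nonempty ι] (v : ι → κ → ℝ) :
    gammaStar (fun x y => ENNReal.ofReal (ed (v x) (v y))) ≤ ENNReal.ofReal (2 * (K0 * wid v)) := by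
  set D : ι → ι → ℝ≥0∞ := fun x y => ENNReal.ofReal (ed (v x) (v y)) with hD
  have hfin : gammaStar D ≠ ⊤ := gammaStar_ne_top D (fun x => by simp [hD, ed_self])
    (ENNReal.ofReal (wid v / c0)) ENNReal.ofReal_ne_top
    (fun x y => ENNReal.ofReal_le_ofReal (diam_le v x y))
  have hM0 : 0 ≤ K0 * wid v := mul_nonneg K0_pos.le (wid_nonneg v)
  have h1 : 2 * (gammaStar D - ENNReal.ofReal (K0 * wid v)) ≤ gammaStar D := by
    refine le_iInf₂ fun N hN => ?_
    have := improve v N hN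
    rw [← tsub_le_iff_right] at this
    refine (mul_le_mul_right this 2).trans (le_of_eq ?_)
    rw [← mul_assoc]
    have : (2 : ℝ≥0∞) * ENNReal.ofReal (1 / 2) = 1 := by
      rw [show (2 : ℝ≥0∞) = ENNReal.ofReal 2 by simp, ← ENNReal.ofReal_mul (by norm_num)]
      norm_num
    rw [this, one_mul]; rfl
  lift gammaStar D to ℝ≥0 using hfin with g
  rw [ENNReal.le_ofReal_iff_toReal_le (by simp) (by positivity)]
  have h2 := ENNReal.toReal_mono (by simp) h1
  by_contra! hcon
  rw [ENNReal.toReal_mul, ENNReal.toReal_sub_of_le, ENNReal.toReal_ofReal hM0] at h2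
  · simp at h2 hcon; linarith
  · rw [ENNReal.ofReal_le_iff_le_toReal (by simp)]; linarith
  · simp

/-! ### Laws of linear forms and the chaining upper bound -/

lemma map_lin {κ : Type*} [Fintype κ] (a : κ → ℝ) :
    (gam κ).map (lin a) = gaussianReal 0 (Real.toNNReal (∑ k, a k ^ 2)) := by
  have : IsProbabilityMeasure ((gam κ).map (lin a)) :=
    Measure.isProbabilityMeasure_map (measurable_lin a).aemeasurable
  refine Measure.ext_of_charFun ?_
  ext t
  rw [charFun_gaussianReal, charFun_apply_real, integral_map (measurable_lin a).aemeasurable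
    (Measurable.aestronglyMeasurable (by fun_prop))]
  have h1 : ∀ ω : κ → ℝ, Complex.exp ((t : ℂ) * (lin a ω : ℝ) * Complex.I) =
      ∏ k, Complex.exp (((t * a k : ℝ) : ℂ) * (ω k : ℝ) * Complex.I) := by
    intro ω
    rw [← Complex.exp_sum]
    congr 1
    unfold lin
    push_cast
    rw [Finset.mul_sum, Finset.sum_mul]
    refine Finset.sum_congr rfl fun k _ => ?_
    ring
  simp_rw [h1]
  unfold gam
  rw [integral_fintype_prod_eq_prod (𝕜 := ℂ)
    (fun k (y : ℝ) => Complex.exp (((t * a k : ℝ) : ℂ) * (y : ℝ) * Complex.I))]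
  have h2 : ∀ k, ∫ y : ℝ, Complex.exp (((t * a k : ℝ) : ℂ) * (y : ℝ) * Complex.I)
      ∂gaussianReal 0 1 = Complex.exp (-(((t * a k : ℝ) : ℂ) ^ 2 / 2)) := by
    intro k
    rw [← charFun_apply_real, charFun_gaussianReal]
    simp
  simp_rw [h2]
  rw [← Complex.exp_sum]
  congr 1
  have h3 : ((Real.toNNReal (∑ k, a k ^ 2) : ℝ≥0) : ℝ) = ∑ k, a k ^ 2 :=
    Real.coe_toNNReal _ (Finset.sum_nonneg fun k _ => sq_nonneg _)
  rw [show (((Real.toNNReal (∑ k, a k ^ 2) : ℝ≥0) : ℂ)) = ((∑ k, a k ^ 2 : ℝ) : ℂ) by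
    exact congrArg (fun r : ℝ => (r : ℂ)) h3]
  push_cast
  rw [Finset.sum_mul, Finset.sum_div, mul_zero, zero_mul, zero_sub, ← Finset.sum_neg_distrib]
  refine Finset.sum_congr rfl fun k _ => ?_
  ring

lemma gauss_tail (b : ℝ) (hb : 1 ≤ b) :
    ∫ g, max (g - b) 0 ∂gaussianReal 0 1 ≤ Real.exp (-(b ^ 2 / 2)) := by
  have hi : Integrable (fun g => Real.exp (-(b ^ 2)) * Real.exp (b * g)) (gaussianReal 0 1) :=
    (integrable_exp_mul_gaussianReal b).const_mul _
  have h1 : ∫ g, max (g - b) 0 ∂gaussianReal 0 1 ≤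
      ∫ g, Real.exp (-(b ^ 2)) * Real.exp (b * g) ∂gaussianReal 0 1 := by
    refine integral_mono_of_nonneg (Filter.Eventually.of_forall fun g => le_max_right _ _) hi
      (Filter.Eventually.of_forall fun g => ?_)
    show max (g - b) 0 ≤ Real.exp (-(b ^ 2)) * Real.exp (b * g)
    rw [← Real.exp_add]
    refine max_le ?_ (Real.exp_pos _).le
    have h2 := Real.add_one_le_exp (-b ^ 2 + b * g)
    rcases le_or_gt g b with h | h
    · have := Real.exp_pos (-(b ^ 2) + b * g); linarith
    · have : -b ^ 2 = -(b ^ 2) := by ring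
      rw [this] at h2
      nlinarith
  refine h1.trans (le_of_eq ?_)
  rw [integral_const_mul]
  have := congrFun (mgf_fun_id_gaussianReal (μ := 0) (v := 1)) b
  unfold mgf at this
  rw [this, ← Real.exp_add]
  congr 1
  simp
  ring

lemma lin_tail {κ : Type*} [Fintype κ] (u w : κ → ℝ) (b : ℝ) (hb : 1 ≤ b) :
    ∫ ω, max (lin (u - w) ω - b * ed u w) 0 ∂gam κ ≤ ed u w * Real.exp (-(b ^ 2 / 2)) := by
  have h1 : (gam κ).map (lin (u - w)) = (gaussianReal 0 1).map (ed u w * ·) := by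
    rw [map_lin, gaussianReal_map_const_mul]
    congr 1
    · simp
    · ext
      simp only [mul_one, NNReal.coe_mk, Pi.sub_apply]
      rw [ed_sq, Real.coe_toNNReal _ (Finset.sum_nonneg fun k _ => sq_nonneg _)]
  have h2 : ∫ ω, max (lin (u - w) ω - b * ed u w) 0 ∂gam κ =
      ∫ y, max (y - b * ed u w) 0 ∂((gam κ).map (lin (u - w))) := by
    rw [integral_map (measurable_lin _).aemeasurable
      (Measurable.aestronglyMeasurable (by fun_prop))]
  rw [h2, h1, integral_map (by fun_prop) (Measurable.aestronglyMeasurable (by fun_prop))]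
  have h3 : ∀ g, max (ed u w * g - b * ed u w) 0 = ed u w * max (g - b) 0 := by
    intro g
    rw [mul_max_of_nonneg _ _ (ed_nonneg u w), mul_zero]
    congr 1; ring
  simp_rw [h3]
  rw [integral_const_mul]
  exact mul_le_mul_of_nonneg_left (gauss_tail b hb) (ed_nonneg _ _)

lemma integrable_tail {κ : Type*} [Fintype κ] (u w : κ → ℝ) (c : ℝ) :
    Integrable (fun ω => max (lin (u - w) ω - c) 0) (gam κ) :=
  ((integrable_lin _).sub (integrable_const c)).pos_part

lemma count_bound (n m : ℕ) (hm : m ≤ 2 ^ 2 ^ n * 2 ^ 2 ^ (n + 1)) :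
    (m : ℝ) * Real.exp (-((4 * Real.sqrt 2 ^ n) ^ 2 / 2)) ≤ (3 / 4) ^ n := by
  have e1 : (4 * Real.sqrt 2 ^ n) ^ 2 / 2 = 8 * 2 ^ n := by
    rw [mul_pow, ← pow_mul, mul_comm n 2, pow_mul, Real.sq_sqrt (by norm_num)]; ring
  have h2 : (m : ℝ) ≤ 2 ^ (3 * 2 ^ n) := by
    have : (m : ℝ) ≤ ((2 ^ 2 ^ n * 2 ^ 2 ^ (n + 1) : ℕ) : ℝ) := by exact_mod_cast hm
    refine this.trans (le_of_eq ?_)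
    push_cast
    rw [← pow_add]
    congr 1
    ring
  have h3 : (2 : ℝ) ^ (3 * 2 ^ n) ≤ Real.exp ((3 * 2 ^ n : ℕ)) := by
    rw [← Real.exp_one_pow]
    exact pow_le_pow_left₀ (by norm_num) (by linarith [Real.add_one_le_exp (1 : ℝ)]) _
  rw [e1]
  calc (m : ℝ) * Real.exp (-(8 * 2 ^ n)) ≤
        Real.exp ((3 * 2 ^ n : ℕ)) * Real.exp (-(8 * 2 ^ n)) := by gcongr; exact h2.trans h3
    _ = Real.exp (-(5 * 2 ^ n)) := by rw [← Real.exp_add]; congr 1; push_cast; ring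
    _ ≤ Real.exp (n * (-1)) := by
        rw [Real.exp_le_exp]
        have : (n : ℝ) ≤ 2 ^ n := by exact_mod_cast (Nat.lt_two_pow_self (n := n)).le
        linarith
    _ = Real.exp (-1) ^ n := by rw [Real.exp_nat_mul]
    _ ≤ (3 / 4) ^ n := pow_le_pow_left₀ (Real.exp_pos _).le
        (by linarith [Real.exp_neg_one_lt_half]) n

lemma chaining {κ ι : Type*} [Fintype κ] [Fintype ι] [Nonempty ι] (v : ι → κ → ℝ)
    (N : ℕ → Finset ι) (hN : ∀ n, (N n).card < 2 ^ 2 ^ n) (p : ℕ → ι → ι)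
    (hp : ∀ n x, p n x ∈ N n) (V : ℝ)
    (hV : ∀ x L, ∑ n ∈ Finset.range L, Real.sqrt 2 ^ n * ed (v x) (v (p n x)) ≤ V) :
    wid v ≤ 16 * V := by
  classical
  have hs2 := sqrt2_pos
  have hs1 : ∀ n : ℕ, 1 ≤ Real.sqrt 2 ^ n := fun n =>
    one_le_pow₀ (by linarith [sqrt2_ge])
  have hV0 : 0 ≤ V := by simpa using hV (Classical.arbitrary ι) 0
  set M := Fintype.card ι with hM
  have hM0 : 0 < M := Fintype.card_pos
  have hMM : ∀ n, M ≤ n → M < 2 ^ 2 ^ n := fun n hn =>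
    hn.trans_lt ((Nat.lt_two_pow_self (n := n)).trans (Nat.lt_two_pow_self (n := 2 ^ n)))
  set q : ℕ → ι → ι := fun n x => if n < M then p n x else x with hq
  set x0 : ι := p 0 (Classical.arbitrary ι) with hx0
  have hq0 : ∀ x, q 0 x = x0 := by
    intro x
    simp only [hq, if_pos hM0]
    have : (N 0).card ≤ 1 := by have := hN 0; simp at this; omega
    exact Finset.card_le_one.1 this _ (hp 0 x) _ (hp 0 _)
  have hqM : ∀ x, q M x = x := by intro x; simp [hq]
  have hqd : ∀ n x, ed (v x) (v (q n x)) ≤ ed (v x) (v (p n x)) := by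
    intro n x
    by_cases h : n < M
    · simp [hq, h]
    · simp only [hq, if_neg h, ed_self]; exact ed_nonneg _ _
  have hqV : ∀ x L, ∑ n ∈ Finset.range L, Real.sqrt 2 ^ n * ed (v x) (v (q n x)) ≤ V := by
    intro x L
    refine le_trans (Finset.sum_le_sum fun n _ => ?_) (hV x L)
    exact mul_le_mul_of_nonneg_left (hqd n x) (by positivity)
  have hqcard : ∀ n, (Finset.univ.image (q n)).card ≤ 2 ^ 2 ^ n := by
    intro n
    by_cases h : n < M
    · refine le_trans (Finset.card_le_card ?_) (hN n).le
      intro y hy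
      obtain ⟨x, -, rfl⟩ := Finset.mem_image.1 hy
      simp only [hq, if_pos h]
      exact hp n x
    · exact Finset.card_image_le.trans (hMM n (not_lt.1 h)).le
  have hlink : ∀ x, ∑ n ∈ Finset.range M, Real.sqrt 2 ^ n * ed (v (q (n + 1) x)) (v (q n x))
      ≤ 2 * V := by
    intro x
    have h1 := hqV x M
    have h2 := hqV x (M + 1)
    rw [Finset.sum_range_succ'] at h2
    have h3 : ∑ n ∈ Finset.range M, Real.sqrt 2 ^ n * ed (v (q (n + 1) x)) (v (q n x)) ≤
        ∑ n ∈ Finset.range M, Real.sqrt 2 ^ n * ed (v x) (v (q n x)) +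
        ∑ n ∈ Finset.range M, Real.sqrt 2 ^ (n + 1) * ed (v x) (v (q (n + 1) x)) := by
      rw [← Finset.sum_add_distrib]
      refine Finset.sum_le_sum fun n _ => ?_
      have a1 := ed_triangle (v (q (n + 1) x)) (v x) (v (q n x))
      rw [ed_comm (v (q (n + 1) x)) (v x)] at a1
      have a2 := mul_le_mul_of_nonneg_left a1 (show 0 ≤ Real.sqrt 2 ^ n by positivity)
      have a3 : Real.sqrt 2 ^ n * ed (v x) (v (q (n + 1) x)) ≤
          Real.sqrt 2 ^ (n + 1) * ed (v x) (v (q (n + 1) x)) := by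
        refine mul_le_mul_of_nonneg_right ?_ (ed_nonneg _ _)
        exact pow_le_pow_right₀ (by linarith [sqrt2_ge]) (Nat.le_succ n)
      linarith
    have h4 : 0 ≤ Real.sqrt 2 ^ 0 * ed (v x) (v (q 0 x)) :=
      mul_nonneg (by positivity) (ed_nonneg _ _)
    linarith
  set P : ℕ → Finset (ι × ι) := fun n => Finset.univ.image fun x => (q (n + 1) x, q n x) with hP
  have hPcard : ∀ n, (P n).card ≤ 2 ^ 2 ^ n * 2 ^ 2 ^ (n + 1) := by
    intro n
    have : P n ⊆ Finset.univ.image (q (n + 1)) ×ˢ Finset.univ.image (q n) := by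
      intro z hz
      obtain ⟨x, -, rfl⟩ := Finset.mem_image.1 hz
      simp
    refine (Finset.card_le_card this).trans ?_
    rw [Finset.card_product, mul_comm]
    exact Nat.mul_le_mul (hqcard n) (hqcard (n + 1))
  have hPd : ∀ n ∈ Finset.range M, ∀ z ∈ P n, ed (v z.1) (v z.2) ≤ 2 * V := by
    intro n hn z hz
    obtain ⟨x, -, rfl⟩ := Finset.mem_image.1 hz
    have h1 := Finset.single_le_sum (f := fun n => Real.sqrt 2 ^ n *
      ed (v (q (n + 1) x)) (v (q n x))) (fun i _ => mul_nonneg (by positivity) (ed_nonneg _ _)) hn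
    have h2 := hlink x
    have h3 := mul_le_mul_of_nonneg_right (hs1 n) (ed_nonneg (v (q (n + 1) x)) (v (q n x)))
    simp only at h1 ⊢
    linarith
  set R : ℕ → (κ → ℝ) → ℝ := fun n ω => ∑ z ∈ P n,
    max (lin (v z.1 - v z.2) ω - (4 * Real.sqrt 2 ^ n) * ed (v z.1) (v z.2)) 0 with hR
  have hRi : ∀ n, Integrable (R n) (gam κ) := fun n =>
    integrable_finsetSum _ fun z _ => integrable_tail _ _ _
  have hRint : ∀ n ∈ Finset.range M, ∫ ω, R n ω ∂gam κ ≤ 2 * V * (3 / 4) ^ n := by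
    intro n hn
    simp only [hR]
    rw [integral_finsetSum _ fun z _ => integrable_tail _ _ _]
    have h1 : ∀ z ∈ P n, ∫ ω, max (lin (v z.1 - v z.2) ω -
        (4 * Real.sqrt 2 ^ n) * ed (v z.1) (v z.2)) 0 ∂gam κ ≤
        2 * V * Real.exp (-((4 * Real.sqrt 2 ^ n) ^ 2 / 2)) := by
      intro z hz
      refine (lin_tail (v z.1) (v z.2) (4 * Real.sqrt 2 ^ n) (by linarith [hs1 n])).trans ?_
      exact mul_le_mul_of_nonneg_right (hPd n hn z hz) (Real.exp_pos _).le
    refine (Finset.sum_le_sum h1).trans ?_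
    rw [Finset.sum_const, nsmul_eq_mul]
    have h2 := mul_le_mul_of_nonneg_left (count_bound n _ (hPcard n)) (show 0 ≤ 2 * V by linarith)
    linarith
  have hpt : ∀ ω x, lin (v x) ω ≤ lin (v x0) ω + (8 * V + ∑ n ∈ Finset.range M, R n ω) := by
    intro ω x
    have h1 : ∑ n ∈ Finset.range M, (lin (v (q (n + 1) x)) ω - lin (v (q n x)) ω) =
        lin (v x) ω - lin (v x0) ω := by
      rw [Finset.sum_range_sub (fun n => lin (v (q n x)) ω), hqM, hq0]
    have h2 : ∑ n ∈ Finset.range M, (lin (v (q (n + 1) x)) ω - lin (v (q n x)) ω) ≤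
        ∑ n ∈ Finset.range M,
          (4 * (Real.sqrt 2 ^ n * ed (v (q (n + 1) x)) (v (q n x))) + R n ω) := by
      refine Finset.sum_le_sum fun n _ => ?_
      have h3 := Finset.single_le_sum (s := P n) (f := fun z : ι × ι =>
        max (lin (v z.1 - v z.2) ω - (4 * Real.sqrt 2 ^ n) * ed (v z.1) (v z.2)) 0)
        (fun z _ => le_max_right _ _) (a := (q (n + 1) x, q n x))
        (Finset.mem_image.2 ⟨x, Finset.mem_univ _, rfl⟩)
      have h4 := le_max_left (lin (v (q (n + 1) x) - v (q n x)) ω -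
        (4 * Real.sqrt 2 ^ n) * ed (v (q (n + 1) x)) (v (q n x))) 0
      have h5 : R n ω = ∑ z ∈ P n,
        max (lin (v z.1 - v z.2) ω - (4 * Real.sqrt 2 ^ n) * ed (v z.1) (v z.2)) 0 := rfl
      rw [← h5] at h3
      have h6 := h4.trans h3
      rw [lin_sub] at h6
      linarith
    rw [Finset.sum_add_distrib, ← Finset.mul_sum] at h2
    have h7 := hlink x
    linarith
  have hRs : Integrable (fun ω => ∑ n ∈ Finset.range M, R n ω) (gam κ) :=
    integrable_finsetSum _ fun n _ => hRi n
  have hc8 : Integrable (fun ω => 8 * V + ∑ n ∈ Finset.range M, R n ω) (gam κ) :=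
    (integrable_const (8 * V)).add hRs
  have hfin : wid v ≤ ∫ ω, (lin (v x0) ω + (8 * V + ∑ n ∈ Finset.range M, R n ω)) ∂gam κ := by
    unfold wid
    refine integral_mono (integrable_wid v) ((integrable_lin (v x0)).add hc8) fun ω => ?_
    exact ciSup_le (hpt ω)
  rw [integral_add (integrable_lin (v x0)) hc8, integral_add (integrable_const _) hRs, integral_lin,
    integral_finsetSum _ (fun n _ => hRi n)] at hfin
  have h8 := Finset.sum_le_sum hRint
  rw [← Finset.mul_sum] at h8
  have h9 := mul_le_mul_of_nonneg_left (geom34 M) (show 0 ≤ 2 * V by linarith)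
  simp at hfin
  linarith

lemma upper {κ ι : Type*} [Fintype κ] [Fintype ι] [Nonempty ι] (v : ι → κ → ℝ) :
    ENNReal.ofReal (wid v) ≤
      16 * gammaStar (fun x y => ENNReal.ofReal (ed (v x) (v y))) := by
  set D : ι → ι → ℝ≥0∞ := fun x y => ENNReal.ofReal (ed (v x) (v y)) with hD
  have hs2 := sqrt2_pos
  rw [mul_comm]
  refine (ENNReal.div_le_iff_le_mul (by simp) (by simp)).1 ?_
  refine le_iInf₂ fun N hN => ?_
  rw [ENNReal.div_le_iff_le_mul (by simp) (by simp)]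
  change _ ≤ val D N * 16
  by_cases hne : ∀ n, (N n).Nonempty
  swap
  · simp only [not_forall, Finset.not_nonempty_iff_eq_empty] at hne
    obtain ⟨n, hn⟩ := hne
    rw [val_eq_top D N n hn, ENNReal.top_mul (by simp)]
    simp
  by_cases htop : val D N = ⊤
  · rw [htop, ENNReal.top_mul (by simp)]; simp
  choose p hp hpe using fun n x => near (N n) (hne n) (D x)
  have := chaining v N hN p hp (val D N).toReal ?_
  · refine (ENNReal.ofReal_le_ofReal this).trans (le_of_eq ?_)
    rw [ENNReal.ofReal_mul (by norm_num), ENNReal.ofReal_toReal htop, mul_comm]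
    simp
  · intro x L
    rw [← ENNReal.ofReal_le_iff_le_toReal htop,
      ENNReal.ofReal_sum_of_nonneg (fun n _ => mul_nonneg (by positivity) (ed_nonneg _ _))]
    refine le_trans ?_ (le_iSup (fun x => ∑' n : ℕ, (2 : ℝ≥0∞) ^ ((n : ℝ) / 2) *
      ⨅ y ∈ N n, D x y) x)
    refine le_trans (le_of_eq ?_) (ENNReal.sum_le_tsum (Finset.range L))
    refine Finset.sum_congr rfl fun n _ => ?_
    rw [two_rpow_half, hpe, ENNReal.ofReal_mul (by positivity)]

/-! ### Transfer to canonical processes -/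

lemma integral_sq_gauss (w : ℝ≥0) : ∫ x, x ^ 2 ∂gaussianReal 0 w = w := by
  have h := variance_fun_id_gaussianReal (μ := 0) (v := w)
  rw [variance_eq_integral measurable_id'.aemeasurable] at h
  simpa using h

lemma transfer {Ω ι : Type*} [MeasureSpace Ω] [Fintype ι] [Nonempty ι]
    (hP : IsProbabilityMeasure (ℙ : Measure Ω)) (X : ι → Ω → ℝ)
    (hX : IsCenteredGaussianProcess X) :
    ∃ (m : ℕ) (v : ι → Fin m → ℝ), ∫ ω, ⨆ x : ι, X x ω = wid v ∧
      ∀ x y, natDist X x y = ed (v x) (v y) := by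
  classical
  obtain ⟨hm, hg⟩ := hX
  have hmc : ∀ c : ι → ℝ, Measurable fun ω => ∑ x, c x * X x ω := fun c =>
    Finset.measurable_sum _ fun x _ => (hm x).const_mul _
  have hL2 : ∀ x, MemLp (X x) 2 (ℙ : Measure Ω) := by
    intro x
    obtain ⟨w, hw⟩ := hg (Pi.single x 1)
    have e : (fun ω => ∑ y, (Pi.single x 1 : ι → ℝ) y * X y ω) = X x := by
      ext ω; simp [Pi.single_apply]
    rw [e] at hw
    have h1 : MemLp id 2 (Measure.map (X x) (ℙ : Measure Ω)) := by
      rw [hw]; exact memLp_id_gaussianReal' 2 (by simp)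
    exact (memLp_map_measure_iff h1.1 (hm x).aemeasurable).1 h1
  have hXX : ∀ x y, Integrable (fun ω => X x ω * X y ω) (ℙ : Measure Ω) := fun x y =>
    (hL2 x).integrable_mul (hL2 y)
  set S : Matrix ι ι ℝ := fun x y => ∫ ω, X x ω * X y ω with hS
  have hquad : ∀ c : ι → ℝ, ∫ ω, (∑ x, c x * X x ω) ^ 2 = ∑ x, ∑ y, c x * c y * S x y := by
    intro c
    have e : ∀ ω, (∑ x, c x * X x ω) ^ 2 = ∑ x, ∑ y, c x * c y * (X x ω * X y ω) := by
      intro ω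
      rw [sq, Finset.sum_mul_sum]
      refine Finset.sum_congr rfl fun x _ => Finset.sum_congr rfl fun y _ => by ring
    simp_rw [e]
    rw [integral_finsetSum _ fun x _ => integrable_finsetSum _ fun y _ => (hXX x y).const_mul _]
    refine Finset.sum_congr rfl fun x _ => ?_
    rw [integral_finsetSum _ fun y _ => (hXX x y).const_mul _]
    refine Finset.sum_congr rfl fun y _ => ?_
    rw [integral_const_mul]
  have hpsd : S.PosSemidef := by
    refine Matrix.PosSemidef.of_dotProduct_mulVec_nonneg ?_ fun c => ?_
    · ext x y
      show ∫ ω, X y ω * X x ω = ∫ ω, X x ω * X y ω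
      simp_rw [mul_comm]
    · have h1 : star c ⬝ᵥ (S.mulVec c) = ∫ ω, (∑ x, c x * X x ω) ^ 2 := by
        rw [hquad]
        simp only [dotProduct, Matrix.mulVec, Pi.star_apply, star_trivial, Finset.mul_sum]
        refine Finset.sum_congr rfl fun x _ => Finset.sum_congr rfl fun y _ => by ring
      rw [h1]
      exact integral_nonneg fun ω => sq_nonneg _
  obtain ⟨m, A, hA⟩ := Matrix.posSemidef_iff_eq_sum_vecMulVec.1 hpsd
  have hSA : ∀ x y, S x y = ∑ k, A k x * A k y := by
    intro x y
    rw [hA, Matrix.sum_apply]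
    simp [Matrix.vecMulVec_apply]
  set v : ι → Fin m → ℝ := fun x k => A k x with hv
  have hquad2 : ∀ c : ι → ℝ, ∫ ω, (∑ x, c x * X x ω) ^ 2 = ∑ k, (∑ x, c x * v x k) ^ 2 := by
    intro c
    rw [hquad]
    simp_rw [hSA, sq, Finset.sum_mul_sum, Finset.mul_sum]
    rw [Finset.sum_comm' (t' := Finset.univ) (s' := fun _ => Finset.univ) (by simp)]
    rw [Finset.sum_comm]
    simp_rw [Finset.sum_comm (s := (Finset.univ : Finset (Fin m)))]
    rw [Finset.sum_comm]
    refine Finset.sum_congr rfl fun x _ => Finset.sum_congr rfl fun y _ =>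
      Finset.sum_congr rfl fun k _ => by simp only [hv]; ring
  have hlaw : ∀ c : ι → ℝ, Measure.map (fun ω => ∑ x, c x * X x ω) (ℙ : Measure Ω) =
      (gam (Fin m)).map (lin (∑ x, c x • v x)) := by
    intro c
    obtain ⟨w, hw⟩ := hg c
    rw [map_lin, hw]
    congr 1
    have h1 := integral_sq_gauss w
    rw [← hw, integral_map (hmc c).aemeasurable
      (Measurable.aestronglyMeasurable (by fun_prop)), hquad2] at h1
    ext
    rw [Real.coe_toNNReal _ (Finset.sum_nonneg fun k _ => sq_nonneg _), ← h1]
    simp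
  have hlin : ∀ (c : ι → ℝ) ω, lin (∑ x, c x • v x) ω = ∑ x, c x * lin (v x) ω := by
    intro c ω
    simp only [lin, Finset.sum_apply, Pi.smul_apply, smul_eq_mul, Finset.sum_mul, Finset.mul_sum]
    rw [Finset.sum_comm]
    refine Finset.sum_congr rfl fun x _ => Finset.sum_congr rfl fun k _ => by ring
  have hmX : Measurable fun ω x => X x ω := measurable_pi_lambda _ hm
  have hmv : Measurable fun (ω : Fin m → ℝ) x => lin (v x) ω :=
    measurable_pi_lambda _ fun x => measurable_lin _
  have hlaw2 : Measure.map (fun ω x => X x ω) (ℙ : Measure Ω) =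
      (gam (Fin m)).map (fun ω x => lin (v x) ω) := by
    have i1 := Measure.isProbabilityMeasure_map (μ := (ℙ : Measure Ω)) hmX.aemeasurable
    have i2 := Measure.isProbabilityMeasure_map (μ := gam (Fin m)) hmv.aemeasurable
    refine Measure.ext_of_charFunDual ?_
    ext L
    have hLe : ∀ z : ι → ℝ, L z = ∑ x, L (Pi.single x 1) * z x := by
      intro z
      conv_lhs => rw [pi_eq_sum_univ' z]
      simp only [map_sum, map_smul, smul_eq_mul]
      refine Finset.sum_congr rfl fun x _ => ?_
      rw [mul_comm]
    rw [charFunDual_eq_charFun_map_one, charFunDual_eq_charFun_map_one,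
      Measure.map_map (by fun_prop) hmX, Measure.map_map (by fun_prop) hmv]
    have h1 := hlaw (fun x => L (Pi.single x 1))
    have e1 : (L ∘ fun ω x => X x ω) = fun ω => ∑ x, L (Pi.single x 1) * X x ω := by
      ext ω; exact hLe _
    have e2 : (L ∘ fun ω x => lin (v x) ω) = lin (∑ x, L (Pi.single x 1) • v x) := by
      ext ω; rw [hlin]; exact hLe _
    rw [e1, e2, h1]
  refine ⟨m, v, ?_, ?_⟩
  · have hms : Measurable fun z : ι → ℝ => ⨆ x, z x := Measurable.iSup fun x => measurable_pi_apply x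
    have h1 := integral_map (μ := (ℙ : Measure Ω)) hmX.aemeasurable
      (hms.aestronglyMeasurable)
    have h2 := integral_map (μ := gam (Fin m)) hmv.aemeasurable (hms.aestronglyMeasurable)
    rw [hlaw2] at h1
    exact h1.symm.trans h2
  · intro x y
    have h1 := hquad2 (Pi.single x 1 - Pi.single y 1)
    unfold natDist
    rw [ed_eq]
    congr 1
    simpa [sub_mul, Finset.sum_sub_distrib, Pi.single_apply] using h1

/-- **The majorizing measure theorem** (Theorem 1.1): for a centered Gaussian
process on a finite index set, `E[sup_{x∈T} X_x] ≍ γ₂*(T)` with universal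
constants. -/
theorem majorizing_measure_theorem :
    ∃ c C : ℝ≥0∞, 0 < c ∧ c ≠ ∞ ∧ 0 < C ∧ C ≠ ∞ ∧
      ∀ (Ω : Type u) (ι : Type v) [MeasureSpace Ω] [Fintype ι] [Nonempty ι],
        ∀ _ : IsProbabilityMeasure (ℙ : Measure Ω),
        ∀ X : ι → Ω → ℝ, IsCenteredGaussianProcess X →
          c * gammaStar (fun x y => ENNReal.ofReal (natDist X x y)) ≤
              ENNReal.ofReal (∫ ω, ⨆ x : ι, X x ω) ∧
            ENNReal.ofReal (∫ ω, ⨆ x : ι, X x ω) ≤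
              C * gammaStar (fun x y => ENNReal.ofReal (natDist X x y)) := by
  have hK := K0_pos
  refine ⟨(ENNReal.ofReal (2 * K0))⁻¹, 16, ?_, ?_, by simp, by simp, ?_⟩
  · rw [ENNReal.inv_pos]; exact ENNReal.ofReal_ne_top
  · rw [ENNReal.inv_ne_top]
    exact (ENNReal.ofReal_pos.2 (by positivity)).ne'
  · intro Ω ι _ _ _ hP X hX
    obtain ⟨m, v, h1, h2⟩ := transfer hP X hX
    have h3 : (fun x y => ENNReal.ofReal (natDist X x y)) =
        fun x y => ENNReal.ofReal (ed (v x) (v y)) := by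
      funext x y; rw [h2]
    rw [h1, h3]
    refine ⟨?_, upper v⟩
    have h4 := lower v
    rw [← mul_assoc, ENNReal.ofReal_mul (by positivity)] at h4
    refine (mul_le_mul_right h4 _).trans (le_of_eq ?_)
    rw [← mul_assoc, ENNReal.inv_mul_cancel (ENNReal.ofReal_pos.2 (by positivity)).ne'
      ENNReal.ofReal_ne_top, one_mul]
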